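/- Let (R, m) be a commutative Noetherian local ring with dim R = d. Then R is Cohen-Macaulay if and only if the Gorenstein flat dimension Gfd_R(H^d_m(R)) equals d. -/

import Mathlib

/-!
Definitions needed to state results of "On flat and Gorenstein flat dimensions of
local cohomology modules" by M.R. Zargar and H. Zakeri.
-/

open CategoryTheory IsLocalRing

universe u

namespace Paper

variable (R : Type u) [CommRing R]

/-! ## Resolution/coresolution dimensions with respect to a class of modules -/

/-- `ResDimLE R P n M` : `M` admits a resolution `0 → Xₙ → ⋯ → X₀ → M → 0`
with each `Xᵢ` in the class `P`. -/
def ResDimLE (P : ModuleCat.{u} R → Prop) : ℕ → ModuleCat.{u} R → Prop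
  | 0, M => P M
  | n + 1, M => ResDimLE P n M ∨
      ∃ (X : ModuleCat.{u} R) (f : X →ₗ[R] M), P X ∧ Function.Surjective f ∧
        ResDimLE P n (ModuleCat.of R (LinearMap.ker f))

/-- `CoresDimLE R P n M` : `M` admits a coresolution `0 → M → X₀ → ⋯ → Xₙ → 0`
with each `Xᵢ` in the class `P`. -/
def CoresDimLE (P : ModuleCat.{u} R → Prop) : ℕ → ModuleCat.{u} R → Prop
  | 0, M => P M
  | n + 1, M => CoresDimLE P n M ∨
      ∃ (X : ModuleCat.{u} R) (f : M →ₗ[R] X), P X ∧ Function.Injective f ∧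
        CoresDimLE P n (ModuleCat.of R (X ⧸ LinearMap.range f))

/-- The resolution dimension of `M` with respect to the class `P`, as an
extended natural number (`⊤` if there is no finite resolution). -/
noncomputable def ResDim (P : ModuleCat.{u} R → Prop) (M : ModuleCat.{u} R) : ℕ∞ :=
  sInf {n : ℕ∞ | ∃ k : ℕ, (k : ℕ∞) = n ∧ ResDimLE R P k M}

/-- The coresolution dimension of `M` with respect to the class `P`. -/
noncomputable def CoresDim (P : ModuleCat.{u} R → Prop) (M : ModuleCat.{u} R) : ℕ∞ :=
  sInf {n : ℕ∞ | ∃ k : ℕ, (k : ℕ∞) = n ∧ CoresDimLE R P k M}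

/-- Flat dimension `fd_R M`. -/
noncomputable def flatDim (M : Type u) [AddCommGroup M] [Module R M] : ℕ∞ :=
  ResDim R (fun N => Module.Flat R N) (ModuleCat.of R M)

/-- Projective dimension `pd_R M`. -/
noncomputable def projDim (M : Type u) [AddCommGroup M] [Module R M] : ℕ∞ :=
  ResDim R (fun N => Module.Projective R N) (ModuleCat.of R M)

/-- Injective dimension `id_R M`. -/
noncomputable def injDim (M : Type u) [AddCommGroup M] [Module R M] : ℕ∞ :=
  CoresDim R (fun N => Module.Injective R N) (ModuleCat.of R M)

/-! ## Local cohomology -/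

/-- The local cohomology module `H^i_𝔞(M)`, as an object of `ModuleCat R`. -/
noncomputable def lcoh (𝔞 : Ideal R) (i : ℕ) (M : Type u) [AddCommGroup M] [Module R M] :
    ModuleCat.{u} R :=
  (localCohomology 𝔞 i).obj (ModuleCat.of R M)

/-- `M` is relative Cohen-Macaulay with respect to `𝔞` with `ht_M 𝔞 = n`, i.e. the
`n`-th local cohomology of `M` with respect to `𝔞` is the only non-vanishing one. -/
def IsRelCM (𝔞 : Ideal R) (n : ℕ) (M : Type u) [AddCommGroup M] [Module R M] : Prop :=
  (∀ i : ℕ, i ≠ n → Subsingleton (lcoh R 𝔞 i M)) ∧ ¬ Subsingleton (lcoh R 𝔞 n M)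

/-! ## Depth, dimension, Cohen-Macaulay -/

/-- The depth of a module over a local ring: the supremum of the lengths of
`M`-regular sequences contained in the maximal ideal. -/
noncomputable def depth [IsLocalRing R] (M : Type u) [AddCommGroup M] [Module R M] : ℕ∞ :=
  sSup {n : ℕ∞ | ∃ rs : List R, (rs.length : ℕ∞) = n ∧ (∀ x ∈ rs, x ∈ maximalIdeal R) ∧
    RingTheory.Sequence.IsRegular M rs}

/-- The (Krull) dimension of a module: the Krull dimension of `R` modulo
the annihilator of `M` (`⊥` for the zero module). -/
noncomputable def moduleDim (M : Type u) [AddCommGroup M] [Module R M] : WithBot ℕ∞ :=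
  ringKrullDim (R ⧸ Module.annihilator R M)

/-- A finitely generated module over a local ring is Cohen-Macaulay
if its depth equals its dimension. -/
def IsCohenMacaulayModule [IsLocalRing R] (M : Type u) [AddCommGroup M] [Module R M] : Prop :=
  (depth R M : WithBot ℕ∞) = moduleDim R M

/-- A local ring is Cohen-Macaulay if it is so as a module over itself. -/
def IsCohenMacaulayRing [IsLocalRing R] : Prop := IsCohenMacaulayModule R R

/-- A local ring is Gorenstein if it has finite injective dimension over itself. -/
def IsGorensteinRing : Prop := injDim R R ≠ ⊤

/-! ## Ext, Tor, semidualizing modules -/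

/-- `Ext^i_R(A, B)`. -/
noncomputable def ext (i : ℕ) (A B : Type u) [AddCommGroup A] [Module R A]
    [AddCommGroup B] [Module R B] : ModuleCat.{u} R :=
  ((Ext R (ModuleCat.{u} R) i).obj (Opposite.op (ModuleCat.of R A))).obj (ModuleCat.of R B)

/-- `Tor^R_p(A, B)` indexed by `p : ℤ`, with the convention that it vanishes in
negative degrees. -/
noncomputable def tor (p : ℤ) (A B : Type u) [AddCommGroup A] [Module R A]
    [AddCommGroup B] [Module R B] : ModuleCat.{u} R :=
  if 0 ≤ p then ((Tor (ModuleCat.{u} R) p.toNat).obj (ModuleCat.of R A)).obj (ModuleCat.of R B)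
  else ModuleCat.of R PUnit

/-- A finitely generated module `C` is semidualizing if the natural map
`R → Hom_R(C, C)` is bijective and `Ext^i_R(C, C) = 0` for all `i ≥ 1`. -/
def IsSemidualizing (C : Type u) [AddCommGroup C] [Module R C] : Prop :=
  Module.Finite R C ∧
  Function.Bijective (fun r : R => (r • LinearMap.id : C →ₗ[R] C)) ∧
  ∀ i : ℕ, 1 ≤ i → Subsingleton (ext R i C C)

/-! ## Gorenstein homological classes -/

/-- `N` is Gorenstein injective: it is the kernel of the `0`-th differential of some
exact complex `Y` of injective modules which stays exact under `Hom(I, -)` for every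
injective module `I`. (The complex is written cohomologically.) -/
def IsGorensteinInjective (N : Type u) [AddCommGroup N] [Module R N] : Prop :=
  ∃ (Y : ℤ → ModuleCat.{u} R) (d : ∀ i : ℤ, Y i →ₗ[R] Y (i + 1)),
    (∀ i, Module.Injective R (Y i)) ∧
    (∀ i, Function.Exact (d i) (d (i + 1))) ∧
    (∀ (I : ModuleCat.{u} R), Module.Injective R I →
      ∀ (i : ℤ) (g : I →ₗ[R] Y (i + 1)), (d (i + 1)).comp g = 0 →
        ∃ h : I →ₗ[R] Y i, (d i).comp h = g) ∧
    ∃ ι : N →ₗ[R] Y 0, Function.Injective ι ∧ Function.Exact ι (d 0)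

/-- `N` is Gorenstein projective: it is the cokernel of a differential of some
exact complex `X` of projective modules which stays exact under `Hom(-, P)` for
every projective module `P`. -/
def IsGorensteinProjective (N : Type u) [AddCommGroup N] [Module R N] : Prop :=
  ∃ (X : ℤ → ModuleCat.{u} R) (d : ∀ i : ℤ, X i →ₗ[R] X (i + 1)),
    (∀ i, Module.Projective R (X i)) ∧
    (∀ i, Function.Exact (d i) (d (i + 1))) ∧
    (∀ (P : ModuleCat.{u} R), Module.Projective R P →
      ∀ (i : ℤ) (g : X (i + 1) →ₗ[R] P), g.comp (d i) = 0 →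
        ∃ h : X (i + 1 + 1) →ₗ[R] P, h.comp (d (i + 1)) = g) ∧
    ∃ π : X 0 →ₗ[R] N, Function.Surjective π ∧ Function.Exact (d (-1)) π

/-- `N` is Gorenstein flat: it is the cokernel of a differential of some exact
complex `Z` of flat modules which stays exact under `- ⊗ I` for every injective
module `I`. -/
def IsGorensteinFlat (N : Type u) [AddCommGroup N] [Module R N] : Prop :=
  ∃ (Z : ℤ → ModuleCat.{u} R) (d : ∀ i : ℤ, Z i →ₗ[R] Z (i + 1)),
    (∀ i, Module.Flat R (Z i)) ∧
    (∀ i, Function.Exact (d i) (d (i + 1))) ∧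
    (∀ (I : ModuleCat.{u} R), Module.Injective R I →
      ∀ i : ℤ, Function.Exact (LinearMap.rTensor (R := R) I (d i))
        (LinearMap.rTensor (R := R) I (d (i + 1)))) ∧
    ∃ π : Z 0 →ₗ[R] N, Function.Surjective π ∧ Function.Exact (d (-1)) π

/-- Gorenstein injective dimension `Gid_R M`. -/
noncomputable def GinjDim (M : Type u) [AddCommGroup M] [Module R M] : ℕ∞ :=
  CoresDim R (fun N => IsGorensteinInjective R N) (ModuleCat.of R M)

/-- Gorenstein projective dimension `Gpd_R M`. -/
noncomputable def GprojDim (M : Type u) [AddCommGroup M] [Module R M] : ℕ∞ :=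
  ResDim R (fun N => IsGorensteinProjective R N) (ModuleCat.of R M)

/-- Gorenstein flat dimension `Gfd_R M`. -/
noncomputable def GflatDim (M : Type u) [AddCommGroup M] [Module R M] : ℕ∞ :=
  ResDim R (fun N => IsGorensteinFlat R N) (ModuleCat.of R M)

/-! ## `C`-injective, `C`-projective, `C`-flat modules and the `G_C`-classes -/

/-- `N` is `C`-injective if `N ≅ Hom_R(C, I)` for some injective module `I`. -/
def IsCInjective (C : Type u) [AddCommGroup C] [Module R C]
    (N : Type u) [AddCommGroup N] [Module R N] : Prop :=
  ∃ I : ModuleCat.{u} R, Module.Injective R I ∧ Nonempty (N ≃ₗ[R] (C →ₗ[R] I))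

/-- `N` is `C`-projective if `N ≅ C ⊗_R P` for some projective module `P`. -/
def IsCProjective (C : Type u) [AddCommGroup C] [Module R C]
    (N : Type u) [AddCommGroup N] [Module R N] : Prop :=
  ∃ P : ModuleCat.{u} R, Module.Projective R P ∧ Nonempty (N ≃ₗ[R] TensorProduct R C P)

/-- `N` is `C`-flat if `N ≅ C ⊗_R F` for some flat module `F`. -/
def IsCFlat (C : Type u) [AddCommGroup C] [Module R C]
    (N : Type u) [AddCommGroup N] [Module R N] : Prop :=
  ∃ F : ModuleCat.{u} R, Module.Flat R F ∧ Nonempty (N ≃ₗ[R] TensorProduct R C F)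

/-- `C`-injective dimension `cid_R M`. -/
noncomputable def cInjDim (C : Type u) [AddCommGroup C] [Module R C]
    (M : Type u) [AddCommGroup M] [Module R M] : ℕ∞ :=
  CoresDim R (fun N => IsCInjective R C N) (ModuleCat.of R M)

/-- `C`-projective dimension `cpd_R M`. -/
noncomputable def cProjDim (C : Type u) [AddCommGroup C] [Module R C]
    (M : Type u) [AddCommGroup M] [Module R M] : ℕ∞ :=
  ResDim R (fun N => IsCProjective R C N) (ModuleCat.of R M)

/-- `N` is `G_C`-injective: `N` is the kernel of the `0`-th differential of an exact
complex `Y` (a complete `I_C I`-coresolution) with `Y i` injective in degrees belonging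
to the coresolution part and `C`-injective elsewhere, such that `Hom(I', Y)` is exact
for every `C`-injective module `I'`. -/
def IsGCInjective (C : Type u) [AddCommGroup C] [Module R C]
    (N : Type u) [AddCommGroup N] [Module R N] : Prop :=
  ∃ (Y : ℤ → ModuleCat.{u} R) (d : ∀ i : ℤ, Y i →ₗ[R] Y (i + 1)),
    (∀ i : ℤ, 0 ≤ i → Module.Injective R (Y i)) ∧
    (∀ i : ℤ, i < 0 → IsCInjective R C (Y i)) ∧
    (∀ i, Function.Exact (d i) (d (i + 1))) ∧
    (∀ (I : ModuleCat.{u} R), IsCInjective R C I →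
      ∀ (i : ℤ) (g : I →ₗ[R] Y (i + 1)), (d (i + 1)).comp g = 0 →
        ∃ h : I →ₗ[R] Y i, (d i).comp h = g) ∧
    ∃ ι : N →ₗ[R] Y 0, Function.Injective ι ∧ Function.Exact ι (d 0)

/-- `N` is `G_C`-projective: the cokernel of the degree `0` differential of a complete
`P_C P`-resolution. -/
def IsGCProjective (C : Type u) [AddCommGroup C] [Module R C]
    (N : Type u) [AddCommGroup N] [Module R N] : Prop :=
  ∃ (X : ℤ → ModuleCat.{u} R) (d : ∀ i : ℤ, X i →ₗ[R] X (i + 1)),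
    (∀ i : ℤ, i ≤ 0 → Module.Projective R (X i)) ∧
    (∀ i : ℤ, 0 < i → IsCProjective R C (X i)) ∧
    (∀ i, Function.Exact (d i) (d (i + 1))) ∧
    (∀ (Q : ModuleCat.{u} R), IsCProjective R C Q →
      ∀ (i : ℤ) (g : X (i + 1) →ₗ[R] Q), g.comp (d i) = 0 →
        ∃ h : X (i + 1 + 1) →ₗ[R] Q, h.comp (d (i + 1)) = g) ∧
    ∃ π : X 0 →ₗ[R] N, Function.Surjective π ∧ Function.Exact (d (-1)) π

/-- `N` is `G_C`-flat: the cokernel of the degree `0` differential of a complete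
`F_C F`-resolution. -/
def IsGCFlat (C : Type u) [AddCommGroup C] [Module R C]
    (N : Type u) [AddCommGroup N] [Module R N] : Prop :=
  ∃ (Z : ℤ → ModuleCat.{u} R) (d : ∀ i : ℤ, Z i →ₗ[R] Z (i + 1)),
    (∀ i : ℤ, i ≤ 0 → Module.Flat R (Z i)) ∧
    (∀ i : ℤ, 0 < i → IsCFlat R C (Z i)) ∧
    (∀ i, Function.Exact (d i) (d (i + 1))) ∧
    (∀ (J : ModuleCat.{u} R), IsCInjective R C J →
      ∀ i : ℤ, Function.Exact (LinearMap.rTensor (R := R) J (d i))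
        (LinearMap.rTensor (R := R) J (d (i + 1)))) ∧
    ∃ π : Z 0 →ₗ[R] N, Function.Surjective π ∧ Function.Exact (d (-1)) π

/-- `G_C`-injective dimension `Gid_C M`. -/
noncomputable def GCinjDim (C : Type u) [AddCommGroup C] [Module R C]
    (M : Type u) [AddCommGroup M] [Module R M] : ℕ∞ :=
  CoresDim R (fun N => IsGCInjective R C N) (ModuleCat.of R M)

/-- `G_C`-projective dimension `G_C-pd_R M`. -/
noncomputable def GCprojDim (C : Type u) [AddCommGroup C] [Module R C]
    (M : Type u) [AddCommGroup M] [Module R M] : ℕ∞ :=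
  ResDim R (fun N => IsGCProjective R C N) (ModuleCat.of R M)

/-- `G_C`-flat dimension `G_C-fd_R M`. -/
noncomputable def GCflatDim (C : Type u) [AddCommGroup C] [Module R C]
    (M : Type u) [AddCommGroup M] [Module R M] : ℕ∞ :=
  ResDim R (fun N => IsGCFlat R C N) (ModuleCat.of R M)

end Paper

open CategoryTheory IsLocalRing

namespace GFaux

variable {R : Type u} [CommRing R]

/-- Short exact sequences, unbundled. -/
structure SES {A B C : Type u} [AddCommGroup A] [Module R A] [AddCommGroup B] [Module R B]
    [AddCommGroup C] [Module R C] (f : A →ₗ[R] B) (g : B →ₗ[R] C) : Prop where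
  inj : Function.Injective f
  exact : Function.Exact f g
  surj : Function.Surjective g

variable {A B C : Type u} [AddCommGroup A] [Module R A] [AddCommGroup B] [Module R B]
    [AddCommGroup C] [Module R C] {f : A →ₗ[R] B} {g : B →ₗ[R] C}

/-- The associated short complex. -/
noncomputable abbrev SES.sc (h : SES f g) : ShortComplex (ModuleCat.{u} R) :=
  ShortComplex.mk (ModuleCat.ofHom f) (ModuleCat.ofHom g) (by
    ext x; exact h.exact.apply_apply_eq_zero x)

lemma SES.shortExact (h : SES f g) : h.sc.ShortExact where
  exact := (ShortComplex.ShortExact.moduleCat_exact_iff_function_exact _).mpr h.exact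
  mono_f := (ModuleCat.mono_iff_injective _).mpr h.inj
  epi_g := (ModuleCat.epi_iff_surjective _).mpr h.surj

lemma SES.dual (h : SES f g) : SES (CharacterModule.dual g) (CharacterModule.dual f) where
  inj := CharacterModule.dual_injective_of_surjective g h.surj
  surj := CharacterModule.dual_surjective_of_injective f h.inj
  exact := by
    intro c
    constructor
    · intro hc
      let e : (B ⧸ LinearMap.ker g) ≃ₗ[R] C := g.quotKerEquivOfSurjective h.surj
      have hk : ∀ b, g b = 0 → c b = 0 := by
        intro b hb
        obtain ⟨a, rfl⟩ := (h.exact b).1 hb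
        exact DFunLike.congr_fun hc a
      let c' : (B ⧸ LinearMap.ker g) →+ AddCircle (1 : ℚ) :=
        QuotientAddGroup.lift (LinearMap.ker g).toAddSubgroup c (by
          intro b hb
          exact hk b hb)
      refine ⟨c'.comp e.symm.toLinearMap.toAddMonoidHom, ?_⟩
      ext b
      change c' (e.symm (g b)) = c b
      have : e.symm (g b) = Submodule.Quotient.mk b := by
        rw [LinearEquiv.symm_apply_eq]; rfl
      rw [this]; rfl
    · rintro ⟨c, rfl⟩
      ext a
      change c (g (f a)) = 0
      rw [h.exact.apply_apply_eq_zero]; exact map_zero c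

variable (R) in
/-- `Tor_n(A, M) = 0`, phrased through `Ext^n(A, M^+)`. -/
def TorZ (n : ℕ) (A M : Type u) [AddCommGroup A] [Module R A] [AddCommGroup M] [Module R M] :
    Prop :=
  Subsingleton (Abelian.Ext (ModuleCat.of R A) (ModuleCat.of R (CharacterModule M)) n)

variable {M : Type u} [AddCommGroup M] [Module R M]

lemma TorZ.eq_zero {n : ℕ} (h : TorZ R n A M)
    (x : Abelian.Ext (ModuleCat.of R A) (ModuleCat.of R (CharacterModule M)) n) : x = 0 :=
  h.elim _ _

lemma TorZ.mid {n : ℕ} (h : SES f g) (hA : TorZ R n A M) (hC : TorZ R n C M) : TorZ R n B M := by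
  refine subsingleton_of_forall_eq 0 fun x => ?_
  obtain ⟨y, hy⟩ := Abelian.Ext.contravariant_sequence_exact₂ h.shortExact _ x (hA.eq_zero _)
  obtain rfl : y = 0 := hC.eq_zero y
  exact hy.symm.trans (by simp)

lemma TorZ.left {n : ℕ} (h : SES f g) (hC : TorZ R (n + 1) C M) (hB : TorZ R n B M) :
    TorZ R n A M := by
  refine subsingleton_of_forall_eq 0 fun x => ?_
  obtain ⟨y, hy⟩ := Abelian.Ext.contravariant_sequence_exact₁ h.shortExact _ x
    (add_comm 1 n) (hC.eq_zero _)
  obtain rfl : y = 0 := hB.eq_zero y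
  exact hy.symm.trans (by simp)

lemma TorZ.right {n : ℕ} (h : SES f g) (hA : TorZ R n A M) (hB : TorZ R (n + 1) B M) :
    TorZ R (n + 1) C M := by
  refine subsingleton_of_forall_eq 0 fun x => ?_
  obtain ⟨y, hy⟩ := Abelian.Ext.contravariant_sequence_exact₃ h.shortExact _ x
    (hB.eq_zero _) (add_comm 1 n)
  obtain rfl : y = 0 := hA.eq_zero y
  exact hy.symm.trans (by simp)

lemma TorZ.mid₂ {n : ℕ} (h : SES f g) (hA : TorZ R n M A) (hC : TorZ R n M C) : TorZ R n M B := by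
  refine subsingleton_of_forall_eq 0 fun x => ?_
  obtain ⟨y, hy⟩ := Abelian.Ext.covariant_sequence_exact₂ _ h.dual.shortExact x (hA.eq_zero _)
  obtain rfl : y = 0 := hC.eq_zero y
  exact hy.symm.trans (by simp)

lemma TorZ.left₂ {n : ℕ} (h : SES f g) (hC : TorZ R (n + 1) M C) (hB : TorZ R n M B) :
    TorZ R n M A := by
  refine subsingleton_of_forall_eq 0 fun x => ?_
  obtain ⟨y, hy⟩ := Abelian.Ext.covariant_sequence_exact₃ _ h.dual.shortExact x
    rfl (hC.eq_zero _)
  obtain rfl : y = 0 := hB.eq_zero y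
  exact hy.symm.trans (by simp)

lemma TorZ.right₂ {n : ℕ} (h : SES f g) (hA : TorZ R n M A) (hB : TorZ R (n + 1) M B) :
    TorZ R (n + 1) M C := by
  refine subsingleton_of_forall_eq 0 fun x => ?_
  obtain ⟨y, hy⟩ := Abelian.Ext.covariant_sequence_exact₁ _ h.dual.shortExact x
    (hB.eq_zero _) rfl
  obtain rfl : y = 0 := hA.eq_zero y
  exact hy.symm.trans (by simp)

lemma TorZ.of_projective [Module.Projective R A] (n : ℕ) : TorZ R (n + 1) A M := by
  have : Projective (ModuleCat.of R A) := (IsProjective.iff_projective A).mp ‹_›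
  exact Abelian.Ext.subsingleton_of_projective _ _ n

lemma TorZ.of_flat₂ [Module.Flat R M] (n : ℕ) : TorZ R (n + 1) A M := by
  have h1 : Module.Injective R (CharacterModule M) :=
    Module.Flat.iff_characterModule_injective.mp ‹_›
  have : Injective (ModuleCat.of R (CharacterModule M)) :=
    Module.injective_object_of_injective_module R (CharacterModule M)
  exact Abelian.Ext.subsingleton_of_injective _ _ n

lemma TorZ.of_subsingleton [Subsingleton A] (n : ℕ) : TorZ R n A M := by
  cases n with
  | succ n =>
    have : Module.Projective R A := inferInstance
    exact TorZ.of_projective n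
  | zero =>
    refine subsingleton_of_forall_eq 0 fun x => ?_
    obtain ⟨y, rfl⟩ := (Abelian.Ext.mk₀_bijective _ _).2 x
    have : y = 0 := by ext a; rw [Subsingleton.elim a 0]; simp
    rw [this, Abelian.Ext.mk₀_zero]

lemma SES.ofEquiv (e : A ≃ₗ[R] B) : SES (e : A →ₗ[R] B) (0 : B →ₗ[R] PUnit.{u+1}) where
  inj := e.injective
  surj := fun x => ⟨0, Subsingleton.elim _ _⟩
  exact := fun b => ⟨fun _ => ⟨e.symm b, by simp⟩, fun _ => rfl⟩

lemma TorZ.congr {n : ℕ} (e : A ≃ₗ[R] B) (h : TorZ R n A M) : TorZ R n B M :=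
  TorZ.mid (SES.ofEquiv e) h (TorZ.of_subsingleton n)

/-- `Tor_1(C, M) = 0` gives injectivity after tensoring. -/
lemma SES.rTensor_injective (h : SES f g) (hC : TorZ R 1 C M) :
    Function.Injective (f.rTensor M) := by
  rw [rTensor_injective_iff_lcomp_surjective]
  intro φ
  obtain ⟨y, hy⟩ := Abelian.Ext.contravariant_sequence_exact₁ h.shortExact
    (ModuleCat.of R (CharacterModule M)) (Abelian.Ext.mk₀ (ModuleCat.ofHom φ)) rfl (hC.eq_zero _)
  obtain ⟨ψ, rfl⟩ := (Abelian.Ext.mk₀_bijective _ _).2 y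
  rw [Abelian.Ext.mk₀_comp_mk₀] at hy
  have := (Abelian.Ext.mk₀_bijective _ _).1 hy
  refine ⟨ψ.hom, ?_⟩
  exact congrArg ModuleCat.Hom.hom this

lemma SES.torZ_one (h : SES f g) (hB : TorZ R 1 B M) (hi : Function.Injective (f.rTensor M)) :
    TorZ R 1 C M := by
  rw [rTensor_injective_iff_lcomp_surjective] at hi
  refine subsingleton_of_forall_eq 0 fun x => ?_
  obtain ⟨y, hy⟩ := Abelian.Ext.contravariant_sequence_exact₃ h.shortExact _ x
    (hB.eq_zero _) (n₀ := 0) rfl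
  obtain ⟨φ, rfl⟩ := (Abelian.Ext.mk₀_bijective _ _).2 y
  obtain ⟨ψ, hψ⟩ := hi φ.hom
  have h1 : φ = h.sc.f ≫ ModuleCat.ofHom ψ := by
    apply ModuleCat.hom_ext; exact hψ.symm
  rw [← hy, h1, ← Abelian.Ext.mk₀_comp_mk₀, ← Abelian.Ext.comp_assoc]
  · rw [h.shortExact.extClass_comp, Abelian.Ext.zero_comp]
  all_goals rfl

variable (R A) in
/-- A free presentation. -/
lemma exists_ses : ∃ (P K : Type u) (_ : AddCommGroup P) (_ : Module R P) (_ : AddCommGroup K)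
    (_ : Module R K) (f : K →ₗ[R] P) (g : P →ₗ[R] A), Module.Projective R P ∧ SES f g := by
  refine ⟨A →₀ R, LinearMap.ker (Finsupp.linearCombination R (id : A → A)), inferInstance,
    inferInstance, inferInstance, inferInstance, Submodule.subtype _,
    Finsupp.linearCombination R (id : A → A), inferInstance, ?_⟩
  exact ⟨Subtype.coe_injective, LinearMap.exact_subtype_ker_map _,
    Finsupp.linearCombination_id_surjective R A⟩

lemma rTensor_inj_of_lTensor (h : Function.Injective (f.lTensor M)) :
    Function.Injective (f.rTensor M) := by
  rw [LinearMap.lTensor_inj_iff_rTensor_inj] at h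
  exact h

lemma SES.lTensor_injective (h : SES f g) (hC : TorZ R 1 M C) :
    Function.Injective (f.lTensor M) := by
  rw [injective_iff_map_eq_zero]
  intro z hz
  refine CharacterModule.eq_zero_of_character_apply fun c => ?_
  let φ := CharacterModule.curry (R := R) c
  obtain ⟨y, hy⟩ := Abelian.Ext.covariant_sequence_exact₃ (ModuleCat.of R M) h.dual.shortExact
    (Abelian.Ext.mk₀ (ModuleCat.ofHom φ)) rfl (hC.eq_zero _)
  obtain ⟨ψ, rfl⟩ := (Abelian.Ext.mk₀_bijective _ _).2 y
  rw [Abelian.Ext.mk₀_comp_mk₀] at hy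
  have h1 := (Abelian.Ext.mk₀_bijective _ _).1 hy
  have h2 : (CharacterModule.dual f) ∘ₗ ψ.hom = φ := congrArg ModuleCat.Hom.hom h1
  have h3 : CharacterModule.uncurry (R := R) ψ.hom (f.lTensor M z) = c z := by
    clear hz
    induction z using TensorProduct.induction_on with
    | zero => simp only [map_zero]
    | add x y hx hy => simp only [map_add, hx, hy]
    | tmul m a =>
      have := DFunLike.congr_fun (DFunLike.congr_fun h2 m) a
      exact this
  rw [← h3, hz, map_zero]

lemma flat_iff_torZ : Module.Flat R A ↔ ∀ (M : Type u) [AddCommGroup M] [Module R M],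
    TorZ R 1 A M := by
  obtain ⟨P, K, _, _, _, _, f, g, hP, h⟩ := exists_ses R A
  constructor
  · intro hA M _ _
    exact h.torZ_one (TorZ.of_projective 0) (rTensor_inj_of_lTensor
      (LinearMap.lTensor_injective_of_exact_of_flat g h.surj f h.inj h.exact _))
  · intro hA
    rw [Module.Flat.iff_lTensor_preserves_injective_linearMap]
    intro N N' _ _ _ _ f hf
    have h : SES f (LinearMap.range f).mkQ :=
      ⟨hf, LinearMap.exact_map_mkQ_range f, Submodule.mkQ_surjective _⟩
    exact h.lTensor_injective (hA _)

lemma TorZ.of_flat [Module.Flat R A] (n : ℕ) : ∀ (M : Type u) [AddCommGroup M] [Module R M],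
    TorZ R (n + 1) A M := by
  induction n with
  | zero => exact flat_iff_torZ.1 ‹_›
  | succ n ih =>
    intro M _ _
    obtain ⟨P, K, _, _, _, _, f, g, hP, h⟩ := exists_ses R M
    exact TorZ.right₂ h (ih K) (TorZ.of_flat₂ _)

lemma TorZ.of_subsingleton₂ [Subsingleton M] (n : ℕ) : TorZ R n A M := by
  cases n with
  | succ n => exact TorZ.of_flat₂ n
  | zero =>
    refine subsingleton_of_forall_eq 0 fun x => ?_
    obtain ⟨y, rfl⟩ := (Abelian.Ext.mk₀_bijective _ _).2 x
    have : y = 0 := by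
      apply ModuleCat.hom_ext
      ext a b
      change (y.hom a) b = 0
      rw [Subsingleton.elim b 0]
      exact map_zero (y.hom a)
    rw [this, Abelian.Ext.mk₀_zero]

lemma TorZ.congr₂ {n : ℕ} (e : A ≃ₗ[R] B) (h : TorZ R n M A) : TorZ R n M B :=
  TorZ.mid₂ (SES.ofEquiv e) h (TorZ.of_subsingleton₂ n)

/-- A submodule inclusion and its quotient. -/
lemma SES.of_injective (f : A →ₗ[R] B) (hf : Function.Injective f) :
    SES f (LinearMap.range f).mkQ :=
  ⟨hf, LinearMap.exact_map_mkQ_range f, Submodule.mkQ_surjective _⟩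

lemma SES.of_surjective (g : B →ₗ[R] C) (hg : Function.Surjective g) :
    SES (LinearMap.ker g).subtype g :=
  ⟨Subtype.coe_injective, LinearMap.exact_subtype_ker_map _, hg⟩

/-- Lift through a surjection killing the kernel. -/
lemma SES.desc (h : SES f g) (φ : B →ₗ[R] M) (hφ : ∀ a, φ (f a) = 0) :
    ∃ ψ : C →ₗ[R] M, ∀ b, ψ (g b) = φ b := by
  let e : (B ⧸ LinearMap.ker g) ≃ₗ[R] C := g.quotKerEquivOfSurjective h.surj
  have hk : LinearMap.ker g ≤ LinearMap.ker φ := by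
    intro b hb
    obtain ⟨a, rfl⟩ := (h.exact b).1 hb
    exact hφ a
  refine ⟨(LinearMap.ker g).liftQ φ hk ∘ₗ e.symm.toLinearMap, fun b => ?_⟩
  have : e.symm (g b) = Submodule.Quotient.mk b := by
    rw [LinearEquiv.symm_apply_eq]; rfl
  simp [this]

end GFaux

open CategoryTheory IsLocalRing

namespace GFaux
open Paper
variable {R : Type u} [CommRing R]

variable (R) in
/-- `Tor_n(M, I) = 0` for `n ≥ 1` and `I` injective. -/
def TT (M : Type u) [AddCommGroup M] [Module R M] : Prop :=
  ∀ (n : ℕ) (I : Type u) [AddCommGroup I] [Module R I], Module.Injective R I → TorZ R (n + 1) M I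

lemma splice {A B C D E : Type*} [AddCommGroup A] [AddCommGroup B] [AddCommGroup C]
    [AddCommGroup D] [AddCommGroup E] [Module R A] [Module R B] [Module R C] [Module R D]
    [Module R E] {g₀ : A →ₗ[R] B} {f₁ : B →ₗ[R] C} {g₁ : C →ₗ[R] D} {f₂ : D →ₗ[R] E}
    (h0 : Function.Surjective g₀) (h1 : Function.Exact f₁ g₁) (h2 : Function.Injective f₂) :
    Function.Exact (f₁ ∘ₗ g₀) (f₂ ∘ₗ g₁) := by
  intro c
  constructor
  · intro h
    have : g₁ c = 0 := h2 (by simpa using h)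
    obtain ⟨b, rfl⟩ := (h1 c).1 this
    obtain ⟨a, rfl⟩ := h0 b
    exact ⟨a, rfl⟩
  · rintro ⟨a, rfl⟩
    simp [h1.apply_apply_eq_zero]

section step

variable {Z : ℤ → ModuleCat.{u} R} {d : ∀ i : ℤ, Z i →ₗ[R] Z (i + 1)}

lemma step_ses (hex : ∀ i, Function.Exact (d i) (d (i + 1))) (i : ℤ) {N : Type u} [AddCommGroup N] [Module R N] (π : Z (i + 1) →ₗ[R] N)
    (hπ : Function.Surjective π) (hπe : Function.Exact (d i) π) :
    ∃ ι : N →ₗ[R] Z (i + 1 + 1), (∀ z, ι (π z) = d (i + 1) z) ∧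
      SES ι (LinearMap.range (d (i + 1))).mkQ := by
  obtain ⟨ι, hι⟩ := (SES.of_surjective π hπ).desc (d (i + 1)) (by
    rintro ⟨a, ha⟩
    obtain ⟨b, rfl⟩ := (hπe a).1 ha
    exact (hex i).apply_apply_eq_zero b)
  refine ⟨ι, hι, ?_, ?_, Submodule.mkQ_surjective _⟩
  · rw [injective_iff_map_eq_zero]
    intro a ha
    obtain ⟨z, rfl⟩ := hπ a
    rw [hι] at ha
    obtain ⟨b, rfl⟩ := (hex i z).1 ha
    exact hπe.apply_apply_eq_zero b
  · intro z
    simp only [Submodule.mkQ_apply, Submodule.Quotient.mk_eq_zero, LinearMap.mem_range]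
    constructor
    · rintro ⟨y, rfl⟩; exact ⟨π y, hι y⟩
    · rintro ⟨n, rfl⟩
      obtain ⟨y, rfl⟩ := hπ n
      exact ⟨y, (hι y).symm⟩

lemma step_TT (hex : ∀ i, Function.Exact (d i) (d (i + 1))) (hfl : ∀ i, Module.Flat R (Z i))
    (hI : ∀ (I : ModuleCat.{u} R), Module.Injective R I →
      ∀ i : ℤ, Function.Exact (LinearMap.rTensor (R := R) I (d i))
        (LinearMap.rTensor (R := R) I (d (i + 1)))) (n : ℕ) :
    ∀ (i : ℤ) {N : Type u} [AddCommGroup N] [Module R N] (π : Z (i + 1) →ₗ[R] N)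
    (_ : Function.Surjective π) (_ : Function.Exact (d i) π)
    (I : Type u) [AddCommGroup I] [Module R I], Module.Injective R I → TorZ R (n + 1) N I := by
  induction n with
  | zero =>
    intro i N _ _ π hπ hπe I _ _ hinj
    obtain ⟨j, rfl⟩ : ∃ j, i = j + 1 := ⟨i - 1, by ring⟩
    let p := (LinearMap.range (d j)).mkQ
    have hp : Function.Surjective p := Submodule.mkQ_surjective _
    obtain ⟨ι, hι, h⟩ := step_ses hex j p hp (LinearMap.exact_map_mkQ_range _)
    have h' : SES ι π := by
      refine ⟨h.inj, fun z => ?_, hπ⟩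
      rw [hπe z, ← h.exact z]
      simp
    have := hfl (j + 1 + 1)
    refine h'.torZ_one (TorZ.of_flat 0 I) ?_
    rw [injective_iff_map_eq_zero]
    intro w hw
    obtain ⟨z, rfl⟩ := LinearMap.rTensor_surjective I hp w
    have e1 : ι.rTensor I (p.rTensor I z) = (d (j + 1)).rTensor I z := by
      rw [← LinearMap.comp_apply, ← LinearMap.rTensor_comp]
      congr 2; ext z; exact hι z
    rw [e1] at hw
    obtain ⟨y, rfl⟩ := (hI (ModuleCat.of R I) hinj j z).1 hw
    rw [← LinearMap.comp_apply, ← LinearMap.rTensor_comp]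
    have : p ∘ₗ d j = 0 := by
      ext z; exact (LinearMap.exact_map_mkQ_range (d j)).apply_apply_eq_zero z
    rw [this]; simp
  | succ n ih =>
    intro i N _ _ π hπ hπe I _ _ hinj
    obtain ⟨j, rfl⟩ : ∃ j, i = j + 1 := ⟨i - 1, by ring⟩
    let p := (LinearMap.range (d j)).mkQ
    have hp : Function.Surjective p := Submodule.mkQ_surjective _
    obtain ⟨ι, hι, h⟩ := step_ses hex j p hp (LinearMap.exact_map_mkQ_range _)
    have h' : SES ι π := by
      refine ⟨h.inj, fun z => ?_, hπ⟩
      rw [hπe z, ← h.exact z]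
      simp
    have := hfl (j + 1 + 1)
    exact TorZ.right h' (ih j p hp (LinearMap.exact_map_mkQ_range _) I hinj) (TorZ.of_flat _ I)

end step

lemma GF_TT {M : Type u} [AddCommGroup M] [Module R M] (h : IsGorensteinFlat R M) : TT R M := by
  obtain ⟨Z, d, hfl, hex, hI, π, hπ, hπe⟩ := h
  intro n I _ _ hinj
  exact step_TT hex hfl hI n (-1) π hπ hπe I hinj

lemma GF_step {M : Type u} [AddCommGroup M] [Module R M] (h : IsGorensteinFlat R M) :
    ∃ (F M' : ModuleCat.{u} R) (f : M →ₗ[R] F) (g : F →ₗ[R] M'), Module.Flat R F ∧ SES f g ∧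
      IsGorensteinFlat R M' := by
  obtain ⟨Z, d, hfl, hex, hI, π, hπ, hπe⟩ := h
  obtain ⟨ι, hι, h⟩ := step_ses hex (-1) π hπ hπe
  have hz : (0 : ℤ) = -1 + 1 := by norm_num
  have key : IsGorensteinFlat R (Z (-1 + 1 + 1) ⧸ (LinearMap.range (d (-1 + 1)))) := by
    refine ⟨fun i => Z (i + 1), fun i => d (i + 1), fun i => hfl _, fun i => hex _,
      fun I hinj i => hI I hinj _, ?_⟩
    have : ∃ π : Z (-1 + 1 + 1) →ₗ[R] (Z (-1 + 1 + 1) ⧸ (LinearMap.range (d (-1 + 1)))),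
        Function.Surjective π ∧ Function.Exact (d (-1 + 1)) π :=
      ⟨(LinearMap.range (d (-1 + 1))).mkQ, h.surj, LinearMap.exact_map_mkQ_range _⟩
    exact this
  exact ⟨Z (-1 + 1 + 1), ModuleCat.of R (Z (-1 + 1 + 1) ⧸ (LinearMap.range (d (-1 + 1)))), ι, _,
    hfl _, h, key⟩

lemma TT.syz {A B C : Type u} [AddCommGroup A] [Module R A] [AddCommGroup B] [Module R B]
    [AddCommGroup C] [Module R C] {f : A →ₗ[R] B} {g : B →ₗ[R] C} (h : SES f g)
    (hB : TT R B) (hC : TT R C) : TT R A := fun n I _ _ hI =>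
  TorZ.left h (hC (n + 1) I hI) (hB n I hI)

lemma TT.of_flat {A : Type u} [AddCommGroup A] [Module R A] [Module.Flat R A] : TT R A :=
  fun n I _ _ _ => TorZ.of_flat n I

/-- Iterated syzygies. -/
noncomputable def syz (N : ModuleCat.{u} R) : ℕ → ModuleCat.{u} R
  | 0 => N
  | n + 1 => ModuleCat.of R (LinearMap.ker (Finsupp.linearCombination R (id : syz N n → syz N n)))

lemma syz_ses (N : ModuleCat.{u} R) (n : ℕ) : ∃ (F : ModuleCat.{u} R) (f : syz N (n + 1) →ₗ[R] F)
    (g : F →ₗ[R] syz N n), Module.Flat R F ∧ SES f g :=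
  ⟨ModuleCat.of R (syz N n →₀ R), _, _, inferInstanceAs (Module.Flat R (syz N n →₀ R)),
    SES.of_surjective _ (Finsupp.linearCombination_id_surjective R _)⟩

lemma GF_of_family (M : ℤ → ModuleCat.{u} R) (hT : ∀ i, TT R (M i))
    (hM : ∀ i, ∃ (F : ModuleCat.{u} R) (f : M i →ₗ[R] F) (g : F →ₗ[R] M (i + 1)),
      Module.Flat R F ∧ SES f g) : IsGorensteinFlat R (M 1) := by
  choose F f g hF h using hM
  refine ⟨F, fun i => f (i + 1) ∘ₗ g i, hF, fun i => splice (h i).surj (h (i + 1)).exact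
    (h (i + 1 + 1)).inj, ?_, g 0, (h 0).surj, ?_⟩
  · intro I hI i
    simp only [LinearMap.rTensor_comp]
    exact splice (LinearMap.rTensor_surjective I (h i).surj)
      (rTensor_exact I (h (i + 1)).exact (h (i + 1)).surj)
      ((h (i + 1 + 1)).rTensor_injective (hT _ 0 I hI))
  · have := splice (h (-1)).surj (h (-1 + 1)).exact (f₂ := LinearMap.id) Function.injective_id
    exact this

/-- Coinduction principle for Gorenstein flatness. -/
lemma GF_coind (Cls : ModuleCat.{u} R → Prop) (hT : ∀ M, Cls M → TT R M)
    (hs : ∀ M, Cls M → ∃ (F M' : ModuleCat.{u} R) (f : M →ₗ[R] F) (g : F →ₗ[R] M'),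
      Module.Flat R F ∧ SES f g ∧ Cls M') (N : ModuleCat.{u} R) (hN : Cls N) :
    IsGorensteinFlat R N := by
  choose F M' f g hF hfg hM' using hs
  let r : ℕ → {M : ModuleCat.{u} R // Cls M} := fun n =>
    Nat.rec ⟨N, hN⟩ (fun _ x => ⟨M' x.1 x.2, hM' x.1 x.2⟩) n
  let M : ℤ → ModuleCat.{u} R
    | Int.ofNat 0 => syz N 1
    | Int.ofNat (n + 1) => (r n).1
    | Int.negSucc n => syz N (n + 2)
  have hsyz : ∀ n, TT R (syz N n) := by
    intro n
    induction n with
    | zero => exact hT N hN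
    | succ n ih =>
      obtain ⟨F, f, g, hF, h⟩ := syz_ses N n
      exact TT.syz h TT.of_flat ih
  have := GF_of_family M (by
    rintro ((_ | n) | n)
    · exact hsyz 1
    · exact hT _ (r n).2
    · exact hsyz _) (by
    rintro ((_ | n) | (_ | n))
    · exact syz_ses N 0
    · exact ⟨F (r n).1 (r n).2, f _ _, g _ _, hF _ _, hfg _ _⟩
    · exact syz_ses N 1
    · exact syz_ses N (n + 2))
  exact this

end GFaux

open CategoryTheory IsLocalRing

namespace GFaux
open Paper
variable {R : Type u} [CommRing R]

section constructions

variable {A B C X Y M : Type u} [AddCommGroup A] [Module R A] [AddCommGroup B] [Module R B]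
    [AddCommGroup C] [Module R C] [AddCommGroup X] [Module R X] [AddCommGroup Y] [Module R Y]
    [AddCommGroup M] [Module R M]
    {f : A →ₗ[R] B} {g : B →ₗ[R] C}

lemma SES.lift (h : SES f g) (φ : M →ₗ[R] B) (hφ : ∀ m, g (φ m) = 0) :
    ∃ ψ : M →ₗ[R] A, ∀ m, f (ψ m) = φ m := by
  refine ⟨(LinearEquiv.ofInjective f h.inj).symm.toLinearMap ∘ₗ
    φ.codRestrict (LinearMap.range f) (fun m => (h.exact _).1 (hφ m)), fun m => ?_⟩
  have := LinearEquiv.ofInjective_symm_apply f (h := h.inj)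
    (φ.codRestrict (LinearMap.range f) (fun m => (h.exact _).1 (hφ m)) m)
  exact this

lemma SES.pushout (h : SES f g) {i : A →ₗ[R] X} {p : X →ₗ[R] Y} (h' : SES i p) :
    ∃ (P : ModuleCat.{u} R) (a : X →ₗ[R] P) (b : P →ₗ[R] C) (c : B →ₗ[R] P) (e : P →ₗ[R] Y),
      SES a b ∧ SES c e := by
  let j : A →ₗ[R] B × X := f.prod (-i)
  have hj : Function.Injective j := fun x y hxy => h.inj (congrArg Prod.fst hxy)
  have hs := SES.of_injective j hj
  obtain ⟨b, hb⟩ := hs.desc (g ∘ₗ LinearMap.fst R B X) (fun a => h.exact.apply_apply_eq_zero a)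
  obtain ⟨e, he⟩ := hs.desc (p ∘ₗ LinearMap.snd R B X) (fun a => by
    simp [j, h'.exact.apply_apply_eq_zero a])
  let q := (LinearMap.range j).mkQ
  have hq : ∀ z, q z = 0 ↔ ∃ a, j a = z := hs.exact
  refine ⟨ModuleCat.of R ((B × X) ⧸ LinearMap.range j), q ∘ₗ LinearMap.inr R B X, b,
    q ∘ₗ LinearMap.inl R B X, e, ⟨?_, ?_, ?_⟩, ⟨?_, ?_, ?_⟩⟩
  · rw [injective_iff_map_eq_zero]
    intro x hx
    obtain ⟨a, ha⟩ := (hq _).1 hx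
    have h1 : f a = 0 := congrArg Prod.fst ha
    have h2 : -i a = x := congrArg Prod.snd ha
    rw [← h2, (injective_iff_map_eq_zero f).1 h.inj a h1]; simp
  · intro z
    obtain ⟨⟨y, x⟩, rfl⟩ := hs.surj z
    rw [hb]
    constructor
    · intro hy
      obtain ⟨a, rfl⟩ := (h.exact y).1 hy
      refine ⟨x + i a, ?_⟩
      rw [← sub_eq_zero, LinearMap.comp_apply, ← map_sub]
      exact (hq _).2 ⟨-a, by simp [j]⟩
    · rintro ⟨x', hx'⟩
      rw [LinearMap.comp_apply, ← sub_eq_zero, ← map_sub, hq] at hx'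
      obtain ⟨a, ha⟩ := hx'
      have h1 : f a = 0 - y := congrArg Prod.fst ha
      have : y = f (-a) := by rw [map_neg, h1]; simp
      simp [this, h.exact.apply_apply_eq_zero]
  · intro c
    obtain ⟨y, rfl⟩ := h.surj c
    exact ⟨q (y, 0), hb _⟩
  · rw [injective_iff_map_eq_zero]
    intro x hx
    obtain ⟨a, ha⟩ := (hq _).1 hx
    have h1 : f a = x := congrArg Prod.fst ha
    have h2 : -i a = 0 := congrArg Prod.snd ha
    rw [← h1, (injective_iff_map_eq_zero i).1 h'.inj a (neg_eq_zero.1 h2)]; simp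
  · intro z
    obtain ⟨⟨y, x⟩, rfl⟩ := hs.surj z
    rw [he]
    constructor
    · intro hy
      obtain ⟨a, rfl⟩ := (h'.exact x).1 hy
      refine ⟨y + f a, ?_⟩
      rw [← sub_eq_zero, LinearMap.comp_apply, ← map_sub]
      exact (hq _).2 ⟨a, by simp [j]⟩
    · rintro ⟨x', hx'⟩
      rw [LinearMap.comp_apply, ← sub_eq_zero, ← map_sub, hq] at hx'
      obtain ⟨a, ha⟩ := hx'
      have h1 : - i a = 0 - x := congrArg Prod.snd ha
      have : x = i a := by simpa using h1.symm
      simp [this, h'.exact.apply_apply_eq_zero]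
  · intro c
    obtain ⟨y, rfl⟩ := h'.surj c
    exact ⟨q (0, y), he _⟩

/-- `A ⊂ B ⊂ X`: sequences for `X/A`. -/
lemma SES.quot (h : SES f g) {c : B →ₗ[R] X} {e : X →ₗ[R] Y} (h' : SES c e) :
    ∃ (H : ModuleCat.{u} R) (q : X →ₗ[R] H) (a : C →ₗ[R] H) (b : H →ₗ[R] Y),
      SES (c ∘ₗ f) q ∧ SES a b ∧ ∀ x, a (g x) = q (c x) := by
  have hs := SES.of_injective (c ∘ₗ f) (h'.inj.comp h.inj)
  let q := (LinearMap.range (c ∘ₗ f)).mkQ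
  obtain ⟨a, ha⟩ := h.desc (q ∘ₗ c) (fun x => hs.exact.apply_apply_eq_zero x)
  obtain ⟨b, hb⟩ := hs.desc e (fun x => h'.exact.apply_apply_eq_zero _)
  refine ⟨ModuleCat.of R (X ⧸ LinearMap.range (c ∘ₗ f)), q, a, b, hs, ⟨?_, ?_, ?_⟩, ha⟩
  · rw [injective_iff_map_eq_zero]
    intro y hy
    obtain ⟨y, rfl⟩ := h.surj y
    rw [ha] at hy
    obtain ⟨x, hx⟩ := (hs.exact _).1 hy
    have := h'.inj hx
    rw [← this, h.exact.apply_apply_eq_zero]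
  · intro z
    obtain ⟨x, rfl⟩ := hs.surj z
    rw [hb, h'.exact x]
    constructor
    · rintro ⟨y, rfl⟩; exact ⟨g y, ha y⟩
    · rintro ⟨y, hy⟩
      obtain ⟨y, rfl⟩ := h.surj y
      rw [ha] at hy
      have h1 : q (c y - x) = 0 := by rw [map_sub, sub_eq_zero]; exact hy
      obtain ⟨w, hw⟩ := (hs.exact _).1 h1
      exact ⟨y - f w, by rw [map_sub]; exact (sub_eq_of_eq_add (by
        rw [← LinearMap.comp_apply, hw]; abel))⟩
  · intro y
    obtain ⟨x, rfl⟩ := h'.surj y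
    exact ⟨q x, hb x⟩

lemma SES.prod : SES (LinearMap.inl R A B) (LinearMap.snd R A B) :=
  ⟨LinearMap.inl_injective, fun ⟨x, y⟩ => ⟨fun h => ⟨x, by simpa using h.symm⟩, by
    rintro ⟨z, hz⟩; exact (congrArg Prod.snd hz).symm⟩, LinearMap.snd_surjective⟩

lemma SES.cover {h : SES f g} {P K : Type u} [AddCommGroup P] [Module R P] [AddCommGroup K]
    [Module R K] {p : P →ₗ[R] B} (hp : Function.Surjective p) {j : K →ₗ[R] P}
    (hj : SES j (g ∘ₗ p)) : ∃ κ : K →ₗ[R] A, Function.Surjective κ ∧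
      SES (j ∘ₗ (LinearMap.ker κ).subtype) p := by
  obtain ⟨κ, hκ⟩ := h.lift (p ∘ₗ j) (fun m => hj.exact.apply_apply_eq_zero m)
  have hκ' : ∀ m, f (κ m) = p (j m) := hκ
  refine ⟨κ, ?_, ?_, ?_, hp⟩
  · intro n
    obtain ⟨x, hx⟩ := hp (f n)
    obtain ⟨k, hk⟩ := (hj.exact x).1 (by
      rw [LinearMap.comp_apply, hx, h.exact.apply_apply_eq_zero])
    exact ⟨k, h.inj (by rw [hκ', hk, hx])⟩
  · exact hj.inj.comp Subtype.coe_injective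
  · intro x
    constructor
    · intro hx
      obtain ⟨k, rfl⟩ := (hj.exact x).1 (by
        rw [LinearMap.comp_apply, hx, map_zero])
      exact ⟨⟨k, h.inj (by rw [hκ', hx, map_zero])⟩, rfl⟩
    · rintro ⟨⟨y, hy⟩, rfl⟩
      have := hκ' y
      rw [show κ y = 0 from hy, map_zero] at this
      exact this.symm

end constructions

section basic

variable {A B C : Type u} [AddCommGroup A] [Module R A] [AddCommGroup B] [Module R B]
    [AddCommGroup C] [Module R C] {f : A →ₗ[R] B} {g : B →ₗ[R] C}

lemma GF_of_flat (A : Type u) [AddCommGroup A] [Module R A] [h : Module.Flat R A] :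
    IsGorensteinFlat R A :=
  GF_coind (fun M => Module.Flat R M) (fun _ _ => TT.of_flat)
    (fun M hM => ⟨M, ModuleCat.of R PUnit.{u+1}, (LinearEquiv.refl R M : M →ₗ[R] M), 0, hM,
      SES.ofEquiv _, inferInstanceAs (Module.Flat R PUnit.{u+1})⟩) (ModuleCat.of R A) h

lemma GF_of_ses (h : SES f g) (hB : Module.Flat R B) (hC : IsGorensteinFlat R C) :
    IsGorensteinFlat R A := by
  refine GF_coind (fun M => IsGorensteinFlat R M ∨ (∃ (F M' : ModuleCat.{u} R) (f : M →ₗ[R] F)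
    (g : F →ₗ[R] M'), Module.Flat R F ∧ SES f g ∧ IsGorensteinFlat R M')) ?_ ?_
    (ModuleCat.of R A) (Or.inr ⟨ModuleCat.of R B, ModuleCat.of R C, f, g, hB, h, hC⟩)
  · rintro M (hM | ⟨F, M', f, g, hF, h, hM'⟩)
    · exact GF_TT hM
    · exact TT.syz h TT.of_flat (GF_TT hM')
  · rintro M (hM | ⟨F, M', f, g, hF, h, hM'⟩)
    · obtain ⟨F, M', f, g, hF, h, hM'⟩ := GF_step hM
      exact ⟨F, M', f, g, hF, h, Or.inl hM'⟩
    · exact ⟨F, M', f, g, hF, h, Or.inl hM'⟩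

lemma flat_mid (h : SES f g) (hA : Module.Flat R A) (hC : Module.Flat R C) :
    Module.Flat R B :=
  flat_iff_torZ.2 fun M _ _ => TorZ.mid h (TorZ.of_flat 0 M) (TorZ.of_flat 0 M)

lemma GF_ext_flat (h : SES f g) (hA : IsGorensteinFlat R A) (hC : Module.Flat R C) :
    IsGorensteinFlat R B := by
  obtain ⟨F, A', i, p, hF, h', hA'⟩ := GF_step hA
  obtain ⟨P, a, b, c, e, h1, h2⟩ := h.pushout h'
  exact GF_of_ses h2 (flat_mid h1 hF hC) hA'

end basic

section character

lemma char_factor {A B : Type u} [AddCommGroup A] [Module R A] [AddCommGroup B] [Module R B]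
    (ψ : A →ₗ[R] B) (c : CharacterModule A) (hc : ∀ a, ψ a = 0 → c a = 0) :
    ∃ y : CharacterModule B, ∀ a, y (ψ a) = c a := by
  have h := SES.of_surjective ψ.rangeRestrict ψ.surjective_rangeRestrict
  obtain ⟨c', hc'⟩ := (h.dual.exact c).1 (by
    ext ⟨a, ha⟩
    exact hc a (congrArg Subtype.val ha))
  obtain ⟨y, rfl⟩ := CharacterModule.dual_surjective_of_injective (LinearMap.range ψ).subtype
    Subtype.coe_injective c'
  exact ⟨y, fun a => DFunLike.congr_fun hc' a⟩

/-- Over a Noetherian ring the character module of an injective module is flat. -/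
lemma flat_character [IsNoetherianRing R] (I : Type u) [AddCommGroup I] [Module R I]
    (hI : Module.Injective R I) : Module.Flat R (CharacterModule I) := by
  classical
  rw [Module.Flat.iff_forall_isTrivialRelation]
  intro l f x hx
  let φ : (Fin l → R) →ₗ[R] R := Fintype.linearCombination R f
  obtain ⟨m, s, hs⟩ := Submodule.fg_iff_exists_fin_generating_family.1
    (IsNoetherian.noetherian (LinearMap.ker φ))
  let ψ : (Fin l → I) →ₗ[R] (Fin m → I) :=
    LinearMap.pi fun j => ∑ i, (s j i) • LinearMap.proj i
  let c : CharacterModule (Fin l → I) :=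
    ∑ i, (x i).comp (LinearMap.proj (R := R) (φ := fun _ : Fin l => I) i).toAddMonoidHom
  have hcv : ∀ t, c t = ∑ i, x i (t i) := by
    intro t
    exact AddMonoidHom.finsetSum_apply (fun i => (x i).comp
      (LinearMap.proj (R := R) (φ := fun _ : Fin l => I) i).toAddMonoidHom) Finset.univ t
  obtain ⟨y, hy⟩ := char_factor ψ c (by
    intro t ht
    -- the map `R^l → I` given by `t`
    let τ : (Fin l → R) →ₗ[R] I := Fintype.linearCombination R t
    have hker : LinearMap.ker φ ≤ LinearMap.ker τ := by
      rw [← hs, Submodule.span_le]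
      rintro _ ⟨j, rfl⟩
      have := congrFun ht j
      simp only [ψ, LinearMap.pi_apply, LinearMap.sum_apply, LinearMap.smul_apply,
        LinearMap.proj_apply, Pi.zero_apply] at this
      simpa [τ, Fintype.linearCombination_apply] using this
    have h := SES.of_surjective φ.rangeRestrict φ.surjective_rangeRestrict
    obtain ⟨τ', hτ'⟩ := h.desc τ (by
      rintro ⟨a, ha⟩
      exact hker (congrArg Subtype.val ha))
    obtain ⟨σ, hσ⟩ := hI.out (LinearMap.range φ).subtype Subtype.coe_injective τ'
    have ht' : ∀ i, t i = f i • σ 1 := by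
      intro i
      have h1 : τ (Pi.single i 1) = t i := by simp [τ]
      have h2 : φ (Pi.single i 1) = f i := by simp [φ]
      rw [← h1, ← hτ', ← hσ, ← map_smul]
      congr 1
      simp [← h2]
    rw [hcv]
    have := DFunLike.congr_fun hx (σ 1)
    simp only [ht']
    exact (AddMonoidHom.finsetSum_apply (fun i => f i • x i) (Finset.univ) (σ 1)).symm.trans this)
  refine ⟨m, fun i j => s j i, fun j => y.comp (LinearMap.single R (fun _ => I) j).toAddMonoidHom,
    ?_, ?_⟩
  · intro i
    ext t
    have h1 : c (Pi.single i t) = x i t := by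
      rw [hcv, Finset.sum_eq_single i]
      · simp
      · intro b _ hb
        rw [Pi.single_eq_of_ne hb]; exact map_zero (x b)
      · simp
    rw [← h1, ← hy]
    have h2 : ψ (Pi.single i t) = ∑ j, Pi.single j (s j i • t) := by
      ext j
      simp only [ψ, LinearMap.pi_apply, LinearMap.sum_apply, LinearMap.smul_apply,
        LinearMap.proj_apply, Finset.sum_apply]
      rw [Finset.sum_eq_single i, Finset.sum_eq_single j]
      · simp
      · intro b _ hb; rw [Pi.single_eq_of_ne hb.symm]
      · simp
      · intro b _ hb; rw [Pi.single_eq_of_ne hb, smul_zero]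
      · simp
    rw [h2, map_sum]
    let yy : Fin m → CharacterModule I := fun j => y.comp
      (LinearMap.single R (fun _ => I) j).toAddMonoidHom
    exact (AddMonoidHom.finsetSum_apply (fun j => s j i • yy j) (Finset.univ) t).symm
  · intro j
    have : (s j : Fin l → R) ∈ LinearMap.ker φ := by
      rw [← hs]; exact Submodule.subset_span ⟨j, rfl⟩
    simpa [φ, Fintype.linearCombination_apply, mul_comm] using this

variable (R) in
/-- Evaluation map into the double character module. -/
def evc (F : Type u) [AddCommGroup F] [Module R F] :
    F →ₗ[R] CharacterModule (CharacterModule F) where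
  toFun x := (AddMonoidHom.eval x : (F →+ AddCircle (1 : ℚ)) →+ AddCircle (1 : ℚ))
  map_add' x y := by ext c; exact map_add c x y
  map_smul' r x := by ext c; rfl

lemma evc_injective (F : Type u) [AddCommGroup F] [Module R F] :
    Function.Injective (evc R F) := by
  rw [injective_iff_map_eq_zero]
  intro x hx
  exact CharacterModule.eq_zero_of_character_apply fun c => DFunLike.congr_fun hx c

lemma flat_evc [IsNoetherianRing R] (F : Type u) [AddCommGroup F] [Module R F]
    [Module.Flat R F] :
    Module.Flat R (CharacterModule (CharacterModule F)) ∧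
    Module.Flat R (CharacterModule (CharacterModule F) ⧸ LinearMap.range (evc R F)) := by
  have h1 : Module.Flat R (CharacterModule (CharacterModule F)) :=
    flat_character _ (Module.Flat.iff_characterModule_injective.mp ‹_›)
  refine ⟨h1, flat_iff_torZ.2 fun M _ _ => ?_⟩
  refine (SES.of_injective _ (evc_injective (R := R) F)).torZ_one (TorZ.of_flat 0 M) ?_
  rw [rTensor_injective_iff_lcomp_surjective]
  intro φ
  refine ⟨CharacterModule.dual (evc R M) ∘ₗ CharacterModule.dual (CharacterModule.dual φ), ?_⟩
  ext x m
  rfl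

end character

section ext

variable [IsNoetherianRing R]
variable {A B C : Type u} [AddCommGroup A] [Module R A] [AddCommGroup B] [Module R B]
    [AddCommGroup C] [Module R C] {f : A →ₗ[R] B} {g : B →ₗ[R] C}

lemma GF_step' {M : Type u} [AddCommGroup M] [Module R M] (h : IsGorensteinFlat R M) :
    ∃ (I M' : ModuleCat.{u} R) (f : M →ₗ[R] CharacterModule I) (g : CharacterModule I →ₗ[R] M'),
      Module.Injective R I ∧ Module.Flat R (CharacterModule I) ∧ SES f g ∧
      IsGorensteinFlat R M' := by
  obtain ⟨F, M', f, g, hF, h, hM'⟩ := GF_step h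
  have h1 := flat_evc (R := R) F
  obtain ⟨H, q, a, b, h2, h3, -⟩ := h.quot (SES.of_injective _ (evc_injective (R := R) F))
  exact ⟨ModuleCat.of R (CharacterModule F), H, _, q,
    Module.Flat.iff_characterModule_injective.mp hF, h1.1, h2, GF_ext_flat h3 hM' h1.2⟩

/-- Gorenstein flat modules are closed under extensions. -/
lemma GF_ext (h : SES f g) (hA : IsGorensteinFlat R A) (hC : IsGorensteinFlat R C) :
    IsGorensteinFlat R B := by
  refine GF_coind (fun B => ∃ (A C : ModuleCat.{u} R) (f : A →ₗ[R] B) (g : B →ₗ[R] C),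
    SES f g ∧ IsGorensteinFlat R A ∧ IsGorensteinFlat R C) ?_ ?_ (ModuleCat.of R B)
    ⟨ModuleCat.of R A, ModuleCat.of R C, f, g, h, hA, hC⟩
  · rintro B ⟨A, C, f, g, h, hA, hC⟩ n I _ _ hI
    exact TorZ.mid h (GF_TT hA n I hI) (GF_TT hC n I hI)
  · rintro B ⟨A, C, f, g, h, hA, hC⟩
    obtain ⟨I, A', α, α', hI, hIf, hα, hA'⟩ := GF_step' hA
    obtain ⟨F, C', γ, γ', hF, hγ, hC'⟩ := GF_step hC
    have hsurj := rTensor_injective_iff_lcomp_surjective.1 (h.rTensor_injective (GF_TT hC 0 I hI))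
    obtain ⟨β, hβ⟩ := hsurj α
    have hβ' : ∀ a, β (f a) = α a := fun a => LinearMap.congr_fun hβ a
    let φ : B →ₗ[R] CharacterModule I × F := β.prod (γ ∘ₗ g)
    have hφ : Function.Injective φ := by
      rw [injective_iff_map_eq_zero]
      intro b hb
      have h1 : γ (g b) = 0 := congrArg Prod.snd hb
      have h2 : g b = 0 := (injective_iff_map_eq_zero γ).1 hγ.inj _ h1
      obtain ⟨a, rfl⟩ := (h.exact b).1 h2
      have h3 : β (f a) = 0 := congrArg Prod.fst hb
      rw [hβ'] at h3
      rw [(injective_iff_map_eq_zero α).1 hα.inj _ h3, map_zero]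
    have hs := SES.of_injective φ hφ
    let q := (LinearMap.range φ).mkQ
    have hq : ∀ z, q z = 0 ↔ ∃ a, φ a = z := hs.exact
    obtain ⟨s, hs1⟩ := hα.desc (q ∘ₗ LinearMap.inl R _ F) (fun a => (hq _).2 ⟨f a, by
      simp [φ, hβ', h.exact.apply_apply_eq_zero]⟩)
    obtain ⟨t, ht⟩ := hs.desc (γ' ∘ₗ LinearMap.snd R (CharacterModule I) F) (fun b => by
      simp [φ, hγ.exact.apply_apply_eq_zero])
    refine ⟨ModuleCat.of R (CharacterModule I × F),
      ModuleCat.of R ((CharacterModule I × F) ⧸ LinearMap.range φ), φ, q,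
      flat_mid SES.prod hIf hF, hs, A', C', s, t, ⟨?_, ?_, ?_⟩,
      hA', hC'⟩
    · rw [injective_iff_map_eq_zero]
      intro x hx
      obtain ⟨x, rfl⟩ := hα.surj x
      rw [hs1] at hx
      obtain ⟨b, hb⟩ := (hq _).1 hx
      have h1 : γ (g b) = 0 := congrArg Prod.snd hb
      have h2 : g b = 0 := (injective_iff_map_eq_zero γ).1 hγ.inj _ h1
      obtain ⟨a, rfl⟩ := (h.exact b).1 h2
      have h3 : β (f a) = x := congrArg Prod.fst hb
      rw [← h3, hβ', hα.exact.apply_apply_eq_zero]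
    · intro z
      obtain ⟨⟨x, y⟩, rfl⟩ := hs.surj z
      rw [ht]
      constructor
      · intro hy
        obtain ⟨c, rfl⟩ := (hγ.exact y).1 hy
        obtain ⟨b, rfl⟩ := h.surj c
        refine ⟨α' (x - β b), ?_⟩
        rw [hs1, LinearMap.comp_apply, ← sub_eq_zero, ← map_sub]
        exact (hq _).2 ⟨-b, by simp [φ]⟩
      · rintro ⟨w, hw⟩
        obtain ⟨w, rfl⟩ := hα.surj w
        rw [hs1, LinearMap.comp_apply, ← sub_eq_zero, ← map_sub] at hw
        obtain ⟨b, hb⟩ := (hq _).1 hw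
        have h1 : γ (g b) = 0 - y := congrArg Prod.snd hb
        have h2 : y = γ (g (-b)) := by rw [map_neg, map_neg, h1]; simp
        simp [h2, hγ.exact.apply_apply_eq_zero]
    · intro c
      obtain ⟨y, rfl⟩ := hγ.surj c
      exact ⟨q (0, y), ht _⟩

end ext

section dims

variable (R) in
/-- flat dimension at most `n`. -/
def FD (n : ℕ) (H : Type u) [AddCommGroup H] [Module R H] : Prop :=
  ∀ i, n < i → ∀ (M : Type u) [AddCommGroup M] [Module R M], TorZ R i H M

variable {A B C : Type u} [AddCommGroup A] [Module R A] [AddCommGroup B] [Module R B]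
    [AddCommGroup C] [Module R C] {f : A →ₗ[R] B} {g : B →ₗ[R] C}

lemma FD.of_flat [Module.Flat R A] : FD R 0 A := by
  intro i hi M _ _
  obtain ⟨i, rfl⟩ := Nat.exists_eq_succ_of_ne_zero hi.ne'
  exact TorZ.of_flat i M

lemma FD.quot {n : ℕ} (h : SES f g) (hA : FD R n A) (hB : Module.Flat R B) : FD R (n + 1) C := by
  intro i hi M _ _
  obtain ⟨i, rfl⟩ := Nat.exists_eq_succ_of_ne_zero (by lia : i ≠ 0)
  exact TorZ.right h (hA i (by lia) M) (TorZ.of_flat i M)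

lemma FD.syz {n : ℕ} (h : SES f g) (hC : FD R (n + 1) C) (hB : Module.Flat R B) : FD R n A := by
  intro i hi M _ _
  obtain ⟨i, rfl⟩ := Nat.exists_eq_succ_of_ne_zero (by lia : i ≠ 0)
  exact TorZ.left h (hC _ (by lia) M) (TorZ.of_flat i M)

lemma FD.mono {n m : ℕ} (h : FD R n A) (hnm : n ≤ m) : FD R m A :=
  fun i hi M _ _ => h i (by lia) M

lemma claimA [IsNoetherianRing R] (d : ℕ) : ∀ (N : ModuleCat.{u} R),
    ResDimLE R (fun N => IsGorensteinFlat R N) d N →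
    ∃ (H G : ModuleCat.{u} R) (f : N →ₗ[R] H) (g : H →ₗ[R] G), SES f g ∧ IsGorensteinFlat R G ∧
      FD R d H := by
  induction d with
  | zero =>
    intro N hN
    obtain ⟨F, M', f, g, hF, h, hM'⟩ := GF_step hN
    exact ⟨F, M', f, g, h, hM', FD.of_flat⟩
  | succ d ih =>
    rintro N (hN | ⟨X, f, hX, hf, hK⟩)
    · obtain ⟨H, G, f, g, h, hG, hH⟩ := ih N hN
      exact ⟨H, G, f, g, h, hG, hH.mono (by lia)⟩
    · obtain ⟨H, G, i, p, h, hG, hH⟩ := ih _ hK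
      obtain ⟨P, a, b, c, e, h1, h2⟩ := (SES.of_surjective f hf).pushout h
      have hP : IsGorensteinFlat R P := GF_ext h2 hX hG
      obtain ⟨F, P', u, v, hF, h3, hP'⟩ := GF_step hP
      obtain ⟨H', q, a', b', h4, h5, -⟩ := h1.quot h3
      exact ⟨H', P', a', b', h5, hP', FD.quot h4 hH hF⟩

lemma resDim_of_FD (n : ℕ) : ∀ (H : ModuleCat.{u} R), FD R n H →
    ResDimLE R (fun N => IsGorensteinFlat R N) n H := by
  induction n with
  | zero =>
    intro H hH
    have : Module.Flat R H := flat_iff_torZ.2 fun M _ _ => hH 1 (by lia) M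
    exact GF_of_flat H
  | succ n ih =>
    intro H hH
    refine Or.inr ⟨ModuleCat.of R (H →₀ R), Finsupp.linearCombination R id, ?_,
      Finsupp.linearCombination_id_surjective R H, ih _ ?_⟩
    · exact GF_of_flat (H →₀ R)
    · exact FD.syz (SES.of_surjective _ (Finsupp.linearCombination_id_surjective R H)) hH
        inferInstance

lemma resDim_of_ses {n : ℕ} {N H G : ModuleCat.{u} R} {f : N →ₗ[R] H} {g : H →ₗ[R] G}
    (h : SES f g) (hH : FD R n H) (hG : IsGorensteinFlat R G) :
    ResDimLE R (fun N => IsGorensteinFlat R N) n N := by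
  cases n with
  | zero =>
    have : Module.Flat R H := flat_iff_torZ.2 fun M _ _ => hH 1 (by lia) M
    exact GF_of_ses h this hG
  | succ n =>
    let p : (H →₀ R) →ₗ[R] H := Finsupp.linearCombination R id
    have hp : Function.Surjective p := Finsupp.linearCombination_id_surjective R H
    have hK := SES.of_surjective (g ∘ₗ p) (h.surj.comp hp)
    have hKGF := GF_of_ses hK inferInstance hG
    obtain ⟨κ, hκs, hs⟩ := SES.cover (h := h) hp hK
    exact Or.inr ⟨ModuleCat.of R (LinearMap.ker (g ∘ₗ p)), κ, hKGF, hκs, resDim_of_FD _ _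
      (FD.syz hs hH inferInstance)⟩

lemma torZ_of_resDim (n : ℕ) : ∀ (N : ModuleCat.{u} R),
    ResDimLE R (fun N => IsGorensteinFlat R N) n N → ∀ i, n < i → ∀ (I : Type u) [AddCommGroup I]
    [Module R I], Module.Injective R I → TorZ R i N I := by
  induction n with
  | zero =>
    intro N hN i hi I _ _ hI
    obtain ⟨i, rfl⟩ := Nat.exists_eq_succ_of_ne_zero hi.ne'
    exact GF_TT hN i I hI
  | succ n ih =>
    rintro N (hN | ⟨X, f, hX, hf, hK⟩) i hi I _ _ hI
    · exact ih N hN i (by lia) I hI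
    · obtain ⟨i, rfl⟩ := Nat.exists_eq_succ_of_ne_zero (by lia : i ≠ 0)
      exact TorZ.right (SES.of_surjective f hf) (ih _ hK i (by lia) I hI) (GF_TT hX i I hI)

end dims

end GFaux

open CategoryTheory IsLocalRing

namespace GFaux
open Paper
variable {R : Type u} [CommRing R]

/-- Multiplication by `x` is bijective. -/
def UDiv (x : R) (M : Type u) [AddCommGroup M] [Module R M] : Prop :=
  Function.Bijective (fun m : M => x • m)

/-- Every element is killed by a power of `x`. -/
def XTor (x : R) (M : Type u) [AddCommGroup M] [Module R M] : Prop :=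
  ∀ m : M, ∃ k : ℕ, x ^ k • m = 0

lemma UDiv.isUnit {x : R} {M : Type u} [AddCommGroup M] [Module R M] (h : UDiv x M)
    (s : Submonoid.powers x) : IsUnit (algebraMap R (Module.End R M) s) := by
  obtain ⟨s, n, rfl⟩ := s
  simp only [map_pow]
  apply IsUnit.pow
  rw [Module.End.isUnit_iff]
  exact h

lemma UDiv.pow {x : R} {M : Type u} [AddCommGroup M] [Module R M] (h : UDiv x M) (k : ℕ) :
    UDiv (x ^ k) M := by
  have := h.isUnit ⟨x ^ k, k, rfl⟩
  rw [Module.End.isUnit_iff] at this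
  exact this

lemma UDiv.of_isLocalizedModule {x : R} {M M' : Type u} [AddCommGroup M] [Module R M]
    [AddCommGroup M'] [Module R M'] (ℓ : M →ₗ[R] M') [IsLocalizedModule (Submonoid.powers x) ℓ] :
    UDiv x M' := by
  have := IsLocalizedModule.map_units (S := Submonoid.powers x) ℓ ⟨x, 1, by simp⟩
  rw [Module.End.isUnit_iff] at this
  exact this

lemma flat_finsupp (ι : Type u) (M : Type u) [AddCommGroup M] [Module R M] [Module.Flat R M] :
    Module.Flat R (ι →₀ M) := by
  classical
  exact Module.Flat.of_linearEquiv (finsuppLEquivDirectSum R M ι)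

lemma UDiv.cover {x : R} {M : Type u} [AddCommGroup M] [Module R M] (h : UDiv x M) :
    ∃ (P K : ModuleCat.{u} R) (f : K →ₗ[R] P) (g : P →ₗ[R] M), SES f g ∧ Module.Flat R P ∧
      UDiv x K := by
  let S := Localization (Submonoid.powers x)
  let g : (M →₀ S) →ₗ[R] M := Finsupp.lsum R (fun m =>
    IsLocalizedModule.lift (Submonoid.powers x) (Algebra.linearMap R S)
      (LinearMap.toSpanSingleton R M m) h.isUnit)
  have hg : Function.Surjective g := by
    intro m
    refine ⟨Finsupp.single m (Algebra.linearMap R S 1), ?_⟩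
    simp only [g, Finsupp.lsum_single]
    rw [IsLocalizedModule.lift_apply]
    simp
  have hS : UDiv x S := UDiv.of_isLocalizedModule (Algebra.linearMap R S)
  have hP : UDiv x (M →₀ S) := by
    constructor
    · intro a b hab
      ext m
      exact hS.1 (DFunLike.congr_fun hab m)
    · intro a
      choose t ht using hS.2
      have ht0 : t 0 = 0 := hS.1 (by simp only [ht]; simp)
      refine ⟨a.mapRange t ht0, ?_⟩
      ext m
      simp only [Finsupp.smul_apply, Finsupp.mapRange_apply]
      exact ht _
  have hSf : Module.Flat R S := inferInstance
  refine ⟨ModuleCat.of R (M →₀ S), ModuleCat.of R (LinearMap.ker g), _, g,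
    SES.of_surjective g hg, flat_finsupp M S, ?_, ?_⟩
  · intro a b hab
    exact Subtype.ext (hP.1 (congrArg Subtype.val hab))
  · rintro ⟨a, ha⟩
    obtain ⟨b, rfl⟩ := hP.2 a
    refine ⟨⟨b, ?_⟩, rfl⟩
    apply h.1
    have : g (x • b) = 0 := ha
    simp only [← map_smul, this, smul_zero]

lemma torZ_of_XTor_UDiv {x : R} {N : Type u} [AddCommGroup N] [Module R N] (hN : XTor x N)
    (i : ℕ) : ∀ {M : Type u} [AddCommGroup M] [Module R M], UDiv x M → TorZ R i N M := by
  induction i with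
  | zero =>
    intro M _ _ hM
    refine subsingleton_of_forall_eq 0 fun e => ?_
    obtain ⟨y, rfl⟩ := (Abelian.Ext.mk₀_bijective _ _).2 e
    have : y = 0 := by
      apply ModuleCat.hom_ext
      ext n m
      obtain ⟨k, hk⟩ := hN n
      obtain ⟨m, rfl⟩ := (hM.pow k).2 m
      change (y.hom n) (x ^ k • m) = 0
      have : y.hom (x ^ k • n) = x ^ k • y.hom n := map_smul _ _ _
      rw [hk, map_zero] at this
      exact (DFunLike.congr_fun this m).symm
    rw [this, Abelian.Ext.mk₀_zero]
  | succ i ih =>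
    intro M _ _ hM
    obtain ⟨P, K, f, g, h, hP, hK⟩ := hM.cover
    exact TorZ.right₂ h (ih hK) (TorZ.of_flat₂ _)

lemma injective_localized [IsNoetherianRing R] (x : R) (I : Type u) [AddCommGroup I] [Module R I]
    (hI : Module.Injective R I) :
    Module.Injective R (LocalizedModule (Submonoid.powers x) I) := by
  apply Module.Baer.injective
  intro J g
  let ℓ := LocalizedModule.mkLinearMap (Submonoid.powers x) I
  have : Module.FinitePresentation R J := Module.finitePresentation_of_finite R J
  obtain ⟨h, s, hs⟩ := Module.FinitePresentation.exists_lift_of_isLocalizedModule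
    (Submonoid.powers x) ℓ g
  obtain ⟨σ, hσ⟩ := hI.out J.subtype Subtype.coe_injective h
  have hu : UDiv x (LocalizedModule (Submonoid.powers x) I) := UDiv.of_isLocalizedModule ℓ
  obtain ⟨s, k, rfl⟩ := s
  obtain ⟨v, hv⟩ := (hu.pow k).2 (ℓ (σ 1))
  refine ⟨LinearMap.toSpanSingleton R _ v, fun y hy => ?_⟩
  apply (hu.pow k).1
  have h1 : ℓ (h ⟨y, hy⟩) = x ^ k • g ⟨y, hy⟩ := LinearMap.congr_fun hs ⟨y, hy⟩
  have h2 : σ y = h ⟨y, hy⟩ := hσ ⟨y, hy⟩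
  have h3 : σ y = y • σ 1 := by rw [← map_smul]; simp
  simp only at hv
  simp only [← h1, ← h2, h3, map_smul, ← hv, LinearMap.toSpanSingleton_apply]
  rw [smul_comm]

lemma exists_injective (M : Type u) [AddCommGroup M] [Module R M] :
    ∃ (I : ModuleCat.{u} R) (f : M →ₗ[R] I), Module.Injective R I ∧ Function.Injective f := by
  obtain ⟨P, K, _, _, _, _, f, g, hP, h⟩ := exists_ses R (CharacterModule M)
  refine ⟨ModuleCat.of R (CharacterModule P), CharacterModule.dual g ∘ₗ evc R M,
    Module.Flat.iff_characterModule_injective.mp inferInstance,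
    (CharacterModule.dual_injective_of_surjective g h.surj).comp (evc_injective M)⟩

lemma exists_syz (n : ℕ) : ∀ (H : ModuleCat.{u} R), FD R (n + 1) H → ∃ Y : ModuleCat.{u} R,
    FD R 1 Y ∧ ∀ (M : Type u) [AddCommGroup M] [Module R M],
      TorZ R 1 Y M ↔ TorZ R (n + 1) H M := by
  induction n with
  | zero => exact fun H hH => ⟨H, hH, fun _ _ _ => Iff.rfl⟩
  | succ n ih =>
    intro H hH
    obtain ⟨P, K, _, _, _, _, f, g, hP, h⟩ := exists_ses R H
    obtain ⟨Y, hY, hY'⟩ := ih (ModuleCat.of R K) (FD.syz h hH inferInstance)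
    refine ⟨Y, hY, fun M _ _ => (hY' M).trans ⟨fun hh => ?_, fun hh => ?_⟩⟩
    · exact TorZ.right h hh (TorZ.of_projective _)
    · exact TorZ.left h hh (TorZ.of_projective _)

/-- If `m` kills `w ∈ I ⊗ F`, `F` flat, then `w` comes from a submodule killed by `m`. -/
lemma exists_sub {F I : Type u} [AddCommGroup F] [Module R F] [Module.Flat R F]
    [AddCommGroup I] [Module R I] (s : Finset R) (w : TensorProduct R I F)
    (hw : ∀ y ∈ s, y • w = 0) :
    ∃ (V : Submodule R I) (w' : TensorProduct R V F), (∀ y ∈ s, ∀ v ∈ V, y • v = 0) ∧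
      V.subtype.rTensor F w' = w := by
  classical
  induction s using Finset.induction_on with
  | empty =>
    obtain ⟨w', hw'⟩ := LinearMap.rTensor_surjective F
      (g := (⊤ : Submodule R I).subtype) (fun i => ⟨⟨i, trivial⟩, rfl⟩) w
    exact ⟨⊤, w', by simp, hw'⟩
  | insert y s hy ih =>
    obtain ⟨V, w', hV, hw'⟩ := ih (fun z hz => hw z (Finset.mem_insert_of_mem hz))
    let μ : V →ₗ[R] V := LinearMap.lsmul R V y
    have hinj := Module.Flat.rTensor_preserves_injective_linearMap (M := F) V.subtype
      Subtype.coe_injective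
    have h1 : μ.rTensor F w' = 0 := by
      apply hinj
      rw [map_zero, ← hw y (Finset.mem_insert_self _ _), ← hw', ← map_smul]
      congr 1
    have hex := Module.Flat.rTensor_exact F (LinearMap.exact_subtype_ker_map μ)
    obtain ⟨w'', hw''⟩ := (hex w').1 h1
    let ι : LinearMap.ker μ →ₗ[R] (LinearMap.ker μ).map V.subtype :=
      V.subtype.submoduleMap (LinearMap.ker μ)
    refine ⟨(LinearMap.ker μ).map V.subtype, ι.rTensor F w'', ?_, ?_⟩
    · rintro z hz _ ⟨v, hv, rfl⟩
      rcases Finset.mem_insert.1 hz with rfl | hz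
      · exact congrArg Subtype.val (show μ v = 0 from hv)
      · exact hV z hz _ v.2
    · rw [← hw', ← hw'', ← LinearMap.comp_apply, ← LinearMap.comp_apply, ← LinearMap.rTensor_comp,
        ← LinearMap.rTensor_comp]
      rfl

lemma SES.lTensor_injective' {A B C M : Type u} [AddCommGroup A] [Module R A] [AddCommGroup B]
    [Module R B] [AddCommGroup C] [Module R C] [AddCommGroup M] [Module R M] {f : A →ₗ[R] B}
    {g : B →ₗ[R] C} (h : SES f g) (hC : TorZ R 1 C M) : Function.Injective (f.lTensor M) := by
  rw [LinearMap.lTensor_inj_iff_rTensor_inj]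
  exact h.rTensor_injective hC

lemma lr_comm {A B C D : Type u} [AddCommGroup A] [Module R A] [AddCommGroup B]
    [Module R B] [AddCommGroup C] [Module R C] [AddCommGroup D] [Module R D] (f : A →ₗ[R] B)
    (g : C →ₗ[R] D) (z : TensorProduct R A C) :
    g.lTensor B (f.rTensor C z) = f.rTensor D (g.lTensor A z) := by
  rw [← LinearMap.comp_apply, ← LinearMap.comp_apply, LinearMap.lTensor_comp_rTensor,
    LinearMap.rTensor_comp_lTensor]

/-- Key step: vanishing of `Tor_1(Y, I)`. -/
lemma key_torZ [IsNoetherianRing R] [IsLocalRing R] (Y : ModuleCat.{u} R) (hY : FD R 1 Y)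
    (h1 : ∀ x ∈ maximalIdeal R, ∀ (I : Type u) [AddCommGroup I] [Module R I],
      Module.Injective R I → UDiv x I → TorZ R 1 Y I)
    (h2 : ∀ (V : Type u) [AddCommGroup V] [Module R V],
      (∀ x ∈ maximalIdeal R, ∀ v : V, x • v = 0) → TorZ R 1 Y V)
    (I : Type u) [AddCommGroup I] [Module R I] (hI : Module.Injective R I) : TorZ R 1 Y I := by
  obtain ⟨P, F, _, _, _, _, j, p, hP, h⟩ := exists_ses R Y
  have hF : Module.Flat R F := flat_iff_torZ.2 fun M _ _ =>
    (FD.syz (n := 0) h hY inferInstance) 1 (by lia) M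
  apply h.torZ_one (TorZ.of_projective 0)
  rw [← LinearMap.lTensor_inj_iff_rTensor_inj]
  by_contra hcon
  let W := LinearMap.ker (j.lTensor I)
  have hWnt : Nontrivial W := by
    rw [Submodule.nontrivial_iff_ne_bot]
    intro hbot
    exact hcon (LinearMap.ker_eq_bot.1 hbot)
  obtain ⟨𝔭, h𝔭⟩ := associatedPrimes.nonempty R W
  obtain ⟨hpr, w, hw⟩ := isAssociatedPrime_iff.1 h𝔭
  have hmem : ∀ r, r ∈ 𝔭 ↔ r • w = 0 := by
    intro r; rw [hw]; simp [Submodule.mem_colon_singleton]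
  have hw0 : (w : TensorProduct R I F) ≠ 0 := by
    intro h0
    apply hpr.ne_top
    rw [Ideal.eq_top_iff_one, hmem, one_smul]
    exact Subtype.ext h0
  have hm : ∀ x ∈ maximalIdeal R, x • (w : TensorProduct R I F) = 0 := by
    intro x hx
    let ℓ := LocalizedModule.mkLinearMap (Submonoid.powers x) I
    have hinj := h.lTensor_injective' (h1 x hx _ (injective_localized x I hI)
      (UDiv.of_isLocalizedModule ℓ))
    have e1 : ℓ.rTensor F (w : TensorProduct R I F) = 0 := by
      apply hinj
      rw [lr_comm, show j.lTensor I w = 0 from w.2, map_zero, map_zero]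
    have : IsLocalizedModule (Submonoid.powers x) (ℓ.rTensor F) :=
      IsLocalizedModule.rTensor (R := R) (A := R) (Submonoid.powers x) ℓ
    obtain ⟨⟨s, k, rfl⟩, hs⟩ := (IsLocalizedModule.eq_zero_iff (Submonoid.powers x)
      (ℓ.rTensor F)).1 e1
    have : x ^ k ∈ 𝔭 := by
      rw [hmem]; exact Subtype.ext hs
    exact congrArg Subtype.val ((hmem x).1 (hpr.mem_of_pow_mem k this))
  obtain ⟨s, hs⟩ := IsNoetherian.noetherian (maximalIdeal R)
  obtain ⟨V, w', hV, hw'⟩ := exists_sub s (w : TensorProduct R I F) (fun y hy => hm y (by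
    rw [← hs]; exact Submodule.subset_span hy))
  have hVm : ∀ x ∈ maximalIdeal R, ∀ v : V, x • v = 0 := by
    intro x hx v
    have : maximalIdeal R ≤ (Submodule.span R {(v : I)}).annihilator := by
      rw [← hs, Submodule.span_le]
      intro y hy
      rw [SetLike.mem_coe, Submodule.mem_annihilator_span_singleton]
      exact hV y hy _ v.2
    exact Subtype.ext ((Submodule.mem_annihilator_span_singleton _ _).1 (this hx))
  have hinj := h.lTensor_injective' (h2 V hVm)
  have hinj2 := Module.Flat.rTensor_preserves_injective_linearMap (M := P) V.subtype
      Subtype.coe_injective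
  have : w' = 0 := by
    apply hinj
    apply hinj2
    rw [← lr_comm, hw', map_zero, map_zero]
    exact w.2
  rw [this, map_zero] at hw'
  exact hw0 hw'.symm

lemma SES.finsupp (S : Type u) {A B C : Type u} [AddCommGroup A] [Module R A] [AddCommGroup B]
    [Module R B] [AddCommGroup C] [Module R C] {f : A →ₗ[R] B} {g : B →ₗ[R] C} (h : SES f g) :
    SES (Finsupp.mapRange.linearMap (α := S) f) (Finsupp.mapRange.linearMap (α := S) g) := by
  refine ⟨Finsupp.mapRange_injective _ (map_zero f) h.inj, ?_,
    Finsupp.mapRange_surjective _ (map_zero g) h.surj⟩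
  intro x
  constructor
  · intro hx
    have h1 : ∀ s, ∃ a, f a = x s := fun s => (h.exact _).1 (DFunLike.congr_fun hx s)
    choose t ht using fun s => h1 s
    have ht0 : ∀ s, t s ≠ 0 → x s ≠ 0 := by
      intro s hs hx0
      exact hs (h.inj (by rw [ht, hx0, map_zero]))
    refine ⟨Finsupp.onFinset x.support t (fun s hs => by simpa using ht0 s hs), ?_⟩
    ext s
    simp [ht]
  · rintro ⟨y, rfl⟩
    ext s
    simp [h.exact.apply_apply_eq_zero]

open scoped Pointwise in
lemma SES.smul {M : Type u} [AddCommGroup M] [Module R M] {x : R} (hx : IsSMulRegular M x) :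
    SES (LinearMap.lsmul R M x) (Submodule.mkQ (x • (⊤ : Submodule R M))) := by
  refine ⟨hx, fun m => ?_, Submodule.mkQ_surjective _⟩
  rw [Submodule.mkQ_apply, Submodule.Quotient.mk_eq_zero, Submodule.mem_smul_pointwise_iff_exists]
  simp

lemma torZ_regular {H : Type u} [AddCommGroup H] [Module R H] (S : Type u) (rs : List R) :
    ∀ (n : ℕ) (M : Type u) [AddCommGroup M] [Module R M],
      (∀ i, n < i → TorZ R i H (S →₀ M)) → RingTheory.Sequence.IsWeaklyRegular M rs →
      ∀ i, n + rs.length < i →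
        TorZ R i H (S →₀ (M ⧸ (Ideal.ofList rs • ⊤ : Submodule R M))) := by
  induction rs with
  | nil =>
    intro n M _ _ h _ i hi
    refine (h i hi).congr₂ (Finsupp.mapRange.linearEquiv ?_)
    refine (Submodule.quotEquivOfEqBot _ ?_).symm
    simp
  | cons x rs ih =>
    intro n M _ _ h hreg i hi
    rw [RingTheory.Sequence.isWeaklyRegular_cons_iff] at hreg
    refine (ih (n + 1) (QuotSMulTop x M) ?_ hreg.2 i (by simp at hi; lia)).congr₂
      (Finsupp.mapRange.linearEquiv (Submodule.quotOfListConsSMulTopEquivQuotSMulTopInner M x rs).symm)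
    intro i hi
    obtain ⟨i, rfl⟩ := Nat.exists_eq_succ_of_ne_zero (by lia : i ≠ 0)
    exact TorZ.right₂ ((SES.smul hreg.1).finsupp S) (h i (by lia)) (h _ (by lia))

/-- A module killed by the maximal ideal is a direct sum of residue fields. -/
lemma exists_basis [IsLocalRing R] (V : Type u) [AddCommGroup V] [Module R V]
    (hV : ∀ x ∈ maximalIdeal R, ∀ v : V, x • v = 0) :
    ∃ S : Type u, Nonempty ((S →₀ (R ⧸ maximalIdeal R)) ≃ₗ[R] V) := by
  have ht : Module.IsTorsionBySet R V (maximalIdeal R) := fun v x => hV x.1 x.2 v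
  letI : Field (R ⧸ maximalIdeal R) := Ideal.Quotient.field _
  letI : Module (R ⧸ maximalIdeal R) V := ht.module
  haveI : IsScalarTower R (R ⧸ maximalIdeal R) V := Module.IsTorsionBySet.isScalarTower ht
  let b := Module.Basis.ofVectorSpace (R ⧸ maximalIdeal R) V
  exact ⟨_, ⟨(b.repr.symm.restrictScalars R)⟩⟩

lemma backward_core [IsNoetherianRing R] [IsLocalRing R] (n : ℕ) (N : ModuleCat.{u} R)
    (hN : ∀ x ∈ maximalIdeal R, XTor x N)
    (hres : ResDimLE R (fun N => IsGorensteinFlat R N) (n + 1) N)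
    (rs : List R) (hrs : RingTheory.Sequence.IsWeaklyRegular R rs) (hlen : rs.length < n + 1)
    (hk : ∃ φ : (R ⧸ maximalIdeal R) →ₗ[R] (R ⧸ (Ideal.ofList rs • ⊤ : Submodule R R)),
      Function.Injective φ) :
    ResDimLE R (fun N => IsGorensteinFlat R N) n N := by
  obtain ⟨H, G, f, g, h, hG, hH⟩ := claimA (n + 1) N hres
  obtain ⟨Y, hY, hYH⟩ := exists_syz n H hH
  have hk2 : ∀ (V : Type u) [AddCommGroup V] [Module R V],
      (∀ x ∈ maximalIdeal R, ∀ v : V, x • v = 0) → TorZ R 1 Y V := by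
    intro V _ _ hV
    rw [hYH]
    obtain ⟨S, ⟨e⟩⟩ := exists_basis V hV
    refine TorZ.congr₂ e ?_
    obtain ⟨φ, hφ⟩ := hk
    refine TorZ.left₂ ((SES.of_injective φ hφ).finsupp S) (hH _ (by lia) _) ?_
    refine torZ_regular S rs 0 R ?_ hrs _ (by lia)
    intro i hi
    obtain ⟨i, rfl⟩ := Nat.exists_eq_succ_of_ne_zero (by lia : i ≠ 0)
    exact TorZ.of_flat₂ i
  have hinj : ∀ (I : Type u) [AddCommGroup I] [Module R I], Module.Injective R I →
      TorZ R (n + 1) H I := by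
    intro I _ _ hI
    rw [← hYH]
    refine key_torZ Y hY ?_ hk2 I hI
    intro x hx I _ _ hI hxI
    rw [hYH]
    exact TorZ.mid h (torZ_of_XTor_UDiv (hN x hx) _ hxI) (GF_TT hG n I hI)
  refine resDim_of_ses h ?_ hG
  intro i hi M _ _
  rcases (Nat.succ_le_of_lt hi).eq_or_lt with rfl | hi'
  · obtain ⟨I, f, hI, hf⟩ := exists_injective (R := R) M
    exact TorZ.left₂ (SES.of_injective f hf) (hH _ (by lia) _) (hinj I hI)
  · exact hH i hi' M

end GFaux

open CategoryTheory IsLocalRing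
namespace GFaux
open Paper Limits
variable {R : Type u} [CommRing R]

section cl
variable (K : CochainComplex (ModuleCat.{u} R) ℕ) (n : ℕ)

/-- the cycle attached to a cocycle -/
noncomputable def cy (z : K.X n) (hz : K.d n (n+1) z = 0) : K.cycles n :=
  K.liftCycles (ModuleCat.ofHom (LinearMap.ker (K.d n (n+1)).hom).subtype) (n+1) (by simp)
    (by ext x; exact x.2) ⟨z, hz⟩

lemma i_inj : Function.Injective (K.iCycles n) :=
  (ModuleCat.mono_iff_injective (K.iCycles n)).1 inferInstance

lemma i_cy (z : K.X n) (hz : K.d n (n+1) z = 0) : K.iCycles n (cy K n z hz) = z := by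
  have := congr_arg (fun f => f.hom ⟨z, hz⟩) (K.liftCycles_i
    (ModuleCat.ofHom (LinearMap.ker (K.d n (n+1)).hom).subtype) (n+1) (by simp)
    (by ext x; exact x.2))
  exact this

/-- the class of a cocycle -/
noncomputable def cl (z : K.X n) (hz : K.d n (n+1) z = 0) : K.homology n :=
  K.homologyπ n (cy K n z hz)

variable {K n}

lemma cl_surj (c : K.homology n) : ∃ z hz, cl K n z hz = c := by
  obtain ⟨y, rfl⟩ := (ModuleCat.epi_iff_surjective (K.homologyπ n)).1 inferInstance c
  have hz : K.d n (n+1) (K.iCycles n y) = 0 := by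
    rw [← ConcreteCategory.comp_apply, HomologicalComplex.iCycles_d]; rfl
  refine ⟨K.iCycles n y, hz, ?_⟩
  rw [cl]
  congr 1
  apply i_inj
  rw [i_cy]

lemma cl_add (z z' : K.X n) (hz hz' h) :
    cl K n (z + z') h = cl K n z hz + cl K n z' hz' := by
  rw [cl, cl, cl, ← map_add]
  congr 1
  apply i_inj
  rw [map_add, i_cy, i_cy, i_cy]

lemma cl_smul (r : R) (z : K.X n) (hz h) :
    cl K n (r • z) h = r • cl K n z hz := by
  rw [cl, cl, ← map_smul]
  congr 1
  apply i_inj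
  rw [map_smul, i_cy, i_cy]

lemma cl_eq_zero_iff (z : K.X n) (hz) (i : ℕ) (hi : (ComplexShape.up ℕ).prev n = i) :
    cl K n z hz = 0 ↔ ∃ y : K.X i, K.d i n y = z := by
  have hex : (ShortComplex.mk (K.toCycles i n) (K.homologyπ n) (by simp)).Exact :=
    ShortComplex.exact_of_g_is_cokernel _ (K.homologyIsCokernel i n hi)
  have h2 := (ShortComplex.moduleCat_exact_iff _).1 hex
  have h3 : ∀ y, K.iCycles n (K.toCycles i n y) = K.d i n y := fun y => by
    rw [← ConcreteCategory.comp_apply, HomologicalComplex.toCycles_i]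
  constructor
  · intro h
    obtain ⟨y, hy⟩ := h2 _ h
    refine ⟨y, ?_⟩
    rw [← h3, ← i_cy K n z hz]
    exact congr_arg (K.iCycles n) hy
  · rintro ⟨y, rfl⟩
    have : cy K n (K.d i n y) hz = K.toCycles i n y := by
      apply i_inj
      rw [i_cy, h3]
    rw [cl, this, ← ConcreteCategory.comp_apply]; simp

lemma cl_map {L : CochainComplex (ModuleCat.{u} R) ℕ} (φ : K ⟶ L) (z : K.X n) (hz)  (hz') :
    HomologicalComplex.homologyMap φ n (cl K n z hz) = cl L n (φ.f n z) hz' := by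
  rw [cl, cl, ← ConcreteCategory.comp_apply, HomologicalComplex.homologyπ_naturality,
    ConcreteCategory.comp_apply]
  congr 1
  apply i_inj
  rw [← ConcreteCategory.comp_apply, HomologicalComplex.cyclesMap_i, ConcreteCategory.comp_apply,
    i_cy, i_cy]

end cl

section ext
variable {X X' : ModuleCat.{u} R} (P : ProjectiveResolution X) (P' : ProjectiveResolution X')

/-- old Ext -/
noncomputable abbrev OExt (n : ℕ) (X Y : ModuleCat.{u} R) : ModuleCat.{u} R :=
  ((_root_.Ext R (ModuleCat.{u} R) n).obj (Opposite.op X)).obj Y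

/-- restriction map -/
noncomputable abbrev OExt.res (n : ℕ) {X' X : ModuleCat.{u} R} (g : X' ⟶ X) (Y : ModuleCat.{u} R) :
  OExt n X Y ⟶ OExt n X' Y :=
  ((_root_.Ext R (ModuleCat.{u} R) n).map g.op).app Y

noncomputable abbrev yonMap (φ : P'.complex ⟶ P.complex) (Y : ModuleCat.{u} R) :
    P.complex.linearYonedaObj R Y ⟶ P'.complex.linearYonedaObj R Y :=
  (HomologicalComplex.unopFunctor _ _).map 
  ((((linearYoneda R (ModuleCat.{u} R)).obj Y).rightOp.mapHomologicalComplex _).map φ).op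

lemma iso_swap {C : Type*} [Category* C] {a b c d : C} (e : a ≅ b) (e' : c ≅ d) (f : a ⟶ c)
    (g : b ⟶ d) (h : f ≫ e'.hom = e.hom ≫ g) : e.inv ≫ f = g ≫ e'.inv := by
  rw [Iso.inv_comp_eq, ← Category.assoc, Iso.eq_comp_inv, h]

lemma isoExt_nat (n : ℕ) (Y : ModuleCat.{u} R) (g : X' ⟶ X) (φ : P'.complex ⟶ P.complex)
    (hφ : φ.f 0 ≫ P.π.f 0 = P'.π.f 0 ≫ g) :
    OExt.res n g Y ≫ (P'.isoExt (R := R) n Y).hom = (P.isoExt (R := R) n Y).hom ≫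
      HomologicalComplex.homologyMap (yonMap P P' φ Y) n := by
  have h1 := ProjectiveResolution.isoLeftDerivedObj_inv_naturality g P' P φ hφ
    ((linearYoneda R (ModuleCat.{u} R)).obj Y).rightOp n
  have h3 := HomologicalComplex.homologyOp_hom_naturality (yonMap P P' φ Y) n
  have h6 : (HomologicalComplex.homologyOp (P'.complex.linearYonedaObj R Y) n).inv ≫
      HomologicalComplex.homologyMap ((HomologicalComplex.opFunctor (ModuleCat R)
        (ComplexShape.up ℕ)).map (yonMap P P' φ Y).op) n =
      (HomologicalComplex.homologyMap (yonMap P P' φ Y) n).op ≫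
      (HomologicalComplex.homologyOp (P.complex.linearYonedaObj R Y) n).inv := by
    exact iso_swap _ _ _ _ h3
  have h7 := congr_arg Quiver.Hom.unop h6
  have h5 : OExt.res n g Y ≫ (P'.isoExt (R := R) n Y).hom =
    (((P'.isoLeftDerivedObj ((linearYoneda R (ModuleCat.{u} R)).obj Y).rightOp n).inv ≫
      (((linearYoneda R (ModuleCat.{u} R)).obj Y).rightOp.leftDerived n).map g).unop) ≫
      (HomologicalComplex.homologyUnop _ _).inv := rfl
  rw [h5, h1]
  exact congr_arg (fun t => (P.isoLeftDerivedObj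
    ((linearYoneda R (ModuleCat R)).obj Y).rightOp n).inv.unop ≫ t) h7

lemma lyd (Y : ModuleCat.{u} R) (i j : ℕ) (f : P.complex.X i ⟶ Y) :
    (P.complex.linearYonedaObj R Y).d i j f = P.complex.d j i ≫ f := rfl

lemma lyf (Y : ModuleCat.{u} R) (φ : P'.complex ⟶ P.complex) (i : ℕ) (f : P.complex.X i ⟶ Y) :
    (yonMap P P' φ Y).f i f = φ.f i ≫ f := rfl

/-- old Ext class of a cocycle -/
noncomputable def OExt.mk {n : ℕ} {Y : ModuleCat.{u} R} (f : P.complex.X n ⟶ Y)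
    (hf : P.complex.d (n+1) n ≫ f = 0) : OExt n X Y :=
  (P.isoExt (R := R) n Y).inv (cl (P.complex.linearYonedaObj R Y) n f hf)

variable {n : ℕ} {Y : ModuleCat.{u} R}

lemma OExt.mk_surj (e : OExt n X Y) : ∃ f hf, OExt.mk P (n := n) (Y := Y) f hf = e := by
  obtain ⟨f, hf, h⟩ := cl_surj ((P.isoExt (R := R) n Y).hom e)
  refine ⟨f, hf, ?_⟩
  unfold OExt.mk
  rw [h]
  exact (P.isoExt (R := R) n Y).toLinearEquiv.symm_apply_apply e

lemma OExt.mk_add (f g : P.complex.X n ⟶ Y) (hf hg h) :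
    OExt.mk P (f + g) h = OExt.mk P f hf + OExt.mk P g hg := by
  rw [OExt.mk, OExt.mk, OExt.mk, ← map_add]
  congr 1
  exact cl_add (K := P.complex.linearYonedaObj R Y) f g _ _ _

lemma OExt.mk_smul (r : R) (f : P.complex.X n ⟶ Y) (hf h) :
    OExt.mk P (r • f) h = r • OExt.mk P f hf := by
  rw [OExt.mk, OExt.mk, ← map_smul]
  congr 1
  exact cl_smul (K := P.complex.linearYonedaObj R Y) r f _ _

lemma OExt.mk_eq_zero_iff (f : P.complex.X n ⟶ Y) (hf) (i : ℕ)
    (hi : (ComplexShape.up ℕ).prev n = i) :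
    OExt.mk P f hf = 0 ↔ ∃ g : P.complex.X i ⟶ Y, P.complex.d n i ≫ g = f := by
  rw [OExt.mk]
  refine ((P.isoExt (R := R) n Y).symm.toLinearEquiv.map_eq_zero_iff).trans ?_
  exact cl_eq_zero_iff (K := P.complex.linearYonedaObj R Y) f hf i hi

lemma OExt.res_mk (g : X' ⟶ X) (φ : P'.complex ⟶ P.complex)
    (hφ : φ.f 0 ≫ P.π.f 0 = P'.π.f 0 ≫ g) (f : P.complex.X n ⟶ Y) (hf hf') :
    OExt.res n g Y (OExt.mk P f hf) = OExt.mk P' (φ.f n ≫ f) hf' := by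
  have h := isoExt_nat P P' n Y g φ hφ
  have h2 : (P.isoExt (R := R) n Y).inv ≫ OExt.res n g Y =
      HomologicalComplex.homologyMap (yonMap P P' φ Y) n ≫ (P'.isoExt (R := R) n Y).inv := by
    rw [Iso.inv_comp_eq, ← Category.assoc, Iso.eq_comp_inv, h]
  rw [OExt.mk, OExt.mk, ← ConcreteCategory.comp_apply, h2, ConcreteCategory.comp_apply]
  congr 1
  exact cl_map (yonMap P P' φ Y) f hf hf'

open CochainComplex.HomComplex in
lemma extMk_eq_zero_iff' (f : P.complex.X n ⟶ Y) (hf) (i : ℕ)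
    (hi : (ComplexShape.up ℕ).prev n = i) :
    P.extMk f (n+1) rfl hf = 0 ↔ ∃ g : P.complex.X i ⟶ Y, P.complex.d n i ≫ g = f := by
  cases n with
  | succ p =>
    obtain rfl : p = i := by simpa using hi
    exact P.extMk_eq_zero_iff f _ rfl hf p rfl
  | zero =>
    obtain rfl : 0 = i := by simpa using hi
    have h0 : P.complex.d 0 0 = 0 := P.complex.shape _ _ (by simp)
    constructor
    · intro h
      simp only [← P.extEquivCohomologyClass.apply_eq_iff_eq,
        ProjectiveResolution.extEquivCohomologyClass_extMk,
        ProjectiveResolution.extEquivCohomologyClass_zero,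
        CohomologyClass.mk_eq_zero_iff] at h
      rw [Cocycle.toSingleMk_mem_coboundaries_iff _ _ _ _ _ 1 (by simp)] at h
      obtain ⟨g, hg⟩ := h
      have hz : IsZero (P.cochainComplex.X 1) := P.cochainComplex.isZero_of_isStrictlyLE 0 1
      have hg0 : g = 0 := hz.eq_of_src _ _
      refine ⟨0, ?_⟩
      rw [hg0, comp_zero] at hg
      rw [comp_zero, ← cancel_epi (P.cochainComplexXIso (-(0:ℕ)) 0 rfl).hom, ← hg, comp_zero]
    · rintro ⟨g, hg⟩
      obtain rfl : f = 0 := by rw [← hg, h0, zero_comp]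
      simp

lemma extMk_smul (r : R) (f : P.complex.X n ⟶ Y) (hf h) :
    P.extMk (r • f) (n+1) rfl h = r • P.extMk f (n+1) rfl hf := by
  rw [Abelian.Ext.smul_eq_comp_mk₀, ProjectiveResolution.extMk_comp_mk₀]
  congr 1

lemma exists_theta (n : ℕ) (X Y : ModuleCat.{u} R) :
    ∃ θ : OExt n X Y ≃ₗ[R] Abelian.Ext X Y n,
      ∀ (f : (projectiveResolution X).complex.X n ⟶ Y) hf,
       θ (OExt.mk (projectiveResolution X) f hf) =
         (projectiveResolution X).extMk f (n+1) rfl hf := by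
  set P := projectiveResolution X
  let Z : Submodule R (P.complex.X n ⟶ Y) :=
    { carrier := {f | P.complex.d (n+1) n ≫ f = 0}
      add_mem' := fun {a b} ha hb => by
        simp only [Set.mem_ofPred_eq] at *; rw [Preadditive.comp_add, ha, hb, add_zero]
      zero_mem' := by simp
      smul_mem' := fun r a ha => by
        simp only [Set.mem_ofPred_eq] at *; rw [Linear.comp_smul, ha, smul_zero] }
  let a : Z →ₗ[R] OExt n X Y :=
    { toFun := fun f => OExt.mk P f.1 f.2
      map_add' := fun f g => OExt.mk_add P f.1 g.1 f.2 g.2 _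
      map_smul' := fun r f => OExt.mk_smul P r f.1 f.2 _ }
  let b : Z →ₗ[R] Abelian.Ext X Y n :=
    { toFun := fun f => P.extMk f.1 (n+1) rfl f.2
      map_add' := fun f g => (P.add_extMk f.1 g.1 _ rfl f.2 g.2).symm
      map_smul' := fun r f => extMk_smul P r f.1 f.2 _ }
  have ha : Function.Surjective a := fun e => by
    obtain ⟨f, hf, h⟩ := OExt.mk_surj P e
    exact ⟨⟨f, hf⟩, h⟩
  have hb : Function.Surjective b := fun e => by
    obtain ⟨f, hf, h⟩ := P.extMk_surjective e (n+1) rfl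
    exact ⟨⟨f, hf⟩, h⟩
  have hk : LinearMap.ker a = LinearMap.ker b := by
    ext f
    exact (OExt.mk_eq_zero_iff P f.1 f.2 _ rfl).trans (extMk_eq_zero_iff' P f.1 f.2 _ rfl).symm
  refine ⟨(a.quotKerEquivOfSurjective ha).symm.trans
    ((Submodule.quotEquivOfEq _ _ hk).trans (b.quotKerEquivOfSurjective hb)), fun f hf => ?_⟩
  have h1 : (a.quotKerEquivOfSurjective ha).symm (OExt.mk P f hf) =
      Submodule.Quotient.mk ⟨f, hf⟩ := by
    rw [LinearEquiv.symm_apply_eq]; rfl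
  rw [LinearEquiv.trans_apply, h1]
  rfl

/-- comparison of the two Ext -/
noncomputable def theta (n : ℕ) (X Y : ModuleCat.{u} R) : OExt n X Y ≃ₗ[R] Abelian.Ext X Y n :=
  (exists_theta n X Y).choose

lemma theta_nat {n : ℕ} {X' X Y : ModuleCat.{u} R} (g : X' ⟶ X) (e : OExt n X Y) :
    theta n X' Y (OExt.res n g Y e) =
      (Abelian.Ext.mk₀ g).comp (theta n X Y e) (zero_add n) := by
  let P := projectiveResolution X
  let P' := projectiveResolution X'
  obtain ⟨f, hf, rfl⟩ := OExt.mk_surj P e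
  let φ := ProjectiveResolution.lift g P' P
  have hφ : φ.f 0 ≫ P.π.f 0 = P'.π.f 0 ≫ g := by
    exact ProjectiveResolution.lift_commutes_zero g P' P
  have hf' : P'.complex.d (n+1) n ≫ φ.f n ≫ f = 0 := by
    rw [← φ.comm_assoc, hf, comp_zero]
  rw [OExt.res_mk P P' g φ hφ f hf hf']
  rw [theta, theta, (exists_theta n X' Y).choose_spec, (exists_theta n X Y).choose_spec]
  exact (P.mk₀_comp_extMk f (n+1) rfl hf (R' := P') (g := g) ⟨φ, hφ⟩).symm

end ext
end GFaux

open CategoryTheory IsLocalRing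
namespace GFaux
open Paper Limits Opposite
variable {R : Type u} [CommRing R]

/-- the diagram computing local cohomology -/
noncomputable abbrev lcD (J : Ideal R) (n : ℕ) (Y : ModuleCat.{u} R) :
    (ℕᵒᵖ)ᵒᵖ ⥤ ModuleCat.{u} R :=
  localCohomology.diagram (localCohomology.idealPowersDiagram J) n ⋙
    (evaluation _ _).obj Y

lemma lcoh_iso (J : Ideal R) (n : ℕ) (Y : ModuleCat.{u} R) :
    Nonempty ((localCohomology J n).obj Y ≅ colimit (lcD J n Y)) := by
  exact ⟨colimitObjIsoColimitCompEvaluation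
    (localCohomology.diagram (localCohomology.idealPowersDiagram J) n) Y⟩

lemma colimit_rep (F : (ℕᵒᵖ)ᵒᵖ ⥤ ModuleCat.{u} R) (c : (colimit F : ModuleCat.{u} R)) :
    ∃ (t : ℕ) (e : F.obj (op (op t))), colimit.ι F (op (op t)) e = c := by
  let r : ℕ → Submodule R (colimit F : ModuleCat.{u} R) := fun t =>
    LinearMap.range (colimit.ι F (op (op t))).hom
  have hmono : Monotone r := by
    intro s t hst
    rintro _ ⟨e, rfl⟩
    refine ⟨F.map (homOfLE hst).op.op e, ?_⟩
    have := colimit.w F (homOfLE hst).op.op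
    exact congr_arg (fun f => f.hom e) this
  have htop : (⨆ t, r t) = ⊤ := by
    have : ModuleCat.ofHom (⨆ t, r t).mkQ = 0 := by
      apply colimit.hom_ext
      intro j
      ext e
      have : (colimit.ι F j) e ∈ ⨆ t, r t := by
        refine Submodule.mem_iSup_of_mem j.unop.unop ⟨e, rfl⟩
      simpa using this
    rw [← Submodule.ker_mkQ (⨆ t, r t)]
    rw [LinearMap.ker_eq_top]
    exact congr_arg ModuleCat.Hom.hom this
  have hc : c ∈ ⨆ t, r t := htop ▸ Submodule.mem_top
  rw [Submodule.mem_iSup_of_directed _ hmono.directed_le] at hc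
  obtain ⟨t, e, he⟩ := hc
  exact ⟨t, e, he⟩

/-- `R/J^t` as an object -/
noncomputable abbrev qp (J : Ideal R) (t : ℕ) : ModuleCat.{u} R := ModuleCat.of R (R ⧸ J ^ t)

/-- transition map -/
noncomputable abbrev qpm (J : Ideal R) {s t : ℕ} (h : s ≤ t) : qp J t ⟶ qp J s :=
  ModuleCat.ofHom (Submodule.mapQ _ _ LinearMap.id (Ideal.pow_le_pow_right h))

lemma OExt.smul_eq_zero (J : Ideal R) (n t : ℕ) (Y : ModuleCat.{u} R) (r : R) (hr : r ∈ J ^ t)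
    (e : OExt n (qp J t) Y) : r • e = 0 := by
  apply (theta n _ _).injective
  rw [map_smul, map_zero, ← Abelian.Ext.mk₀_id_comp (theta n (qp J t) Y e),
    ← Abelian.Ext.smul_comp, ← Abelian.Ext.mk₀_smul]
  have : r • 𝟙 (qp J t) = 0 := by
    refine ModuleCat.hom_ext (LinearMap.ext fun x => ?_)
    obtain ⟨x, rfl⟩ := Submodule.Quotient.mk_surjective _ x
    change r • Submodule.Quotient.mk x = (0 : R ⧸ J ^ t)
    rw [← Submodule.Quotient.mk_smul, Submodule.Quotient.mk_eq_zero]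
    exact Ideal.mul_mem_right _ _ hr
  rw [this]; simp

lemma lcoh_XTor (J : Ideal R) (n : ℕ) (Y : ModuleCat.{u} R) (x : R) (hx : x ∈ J) :
    XTor x ((localCohomology J n).obj Y) := by
  obtain ⟨i⟩ := lcoh_iso J n Y
  intro c
  obtain ⟨t, e, he⟩ := colimit_rep _ (i.hom c)
  refine ⟨t, i.toLinearEquiv.injective ?_⟩
  change i.hom _ = i.hom _
  rw [map_smul, map_zero, ← he, ← map_smul]
  rw [show x ^ t • e = 0 from OExt.smul_eq_zero J n t Y _ (Ideal.pow_mem_pow hx t) e, map_zero]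

lemma lcoh_equiv (J : Ideal R) (n : ℕ) (Y : ModuleCat.{u} R) (M : Type u) [AddCommGroup M]
    [Module R M] (ψ : ∀ t, OExt n (qp J t) Y →ₗ[R] M) (hinj : ∀ t, Function.Injective (ψ t))
    (hsurj : ∀ m, ∃ t e, ψ t e = m)
    (hcomp : ∀ s t (h : s ≤ t) e, ψ t (OExt.res n (qpm J h) Y e) = ψ s e) :
    Nonempty ((localCohomology J n).obj Y ≃ₗ[R] M) := by
  obtain ⟨i⟩ := lcoh_iso J n Y
  let c : Cocone (lcD J n Y) :=
    { pt := ModuleCat.of R M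
      ι := { app := fun j => ModuleCat.ofHom (ψ j.unop.unop)
             naturality := by
              intro j j' f
              ext e
              exact hcomp _ _ f.unop.unop.le e } }
  let d : colimit (lcD J n Y) ⟶ ModuleCat.of R M := colimit.desc _ c
  have hd : ∀ t e, d (colimit.ι (lcD J n Y) (op (op t)) e) = ψ t e := fun t e => by
    have := colimit.ι_desc c (op (op t))
    exact congr_arg (fun f => f.hom e) this
  refine ⟨i.toLinearEquiv.trans (LinearEquiv.ofBijective d.hom ⟨?_, ?_⟩)⟩
  · rw [injective_iff_map_eq_zero]
    intro a ha
    obtain ⟨t, e, rfl⟩ := colimit_rep _ a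
    have h1 : ψ t e = ψ t 0 := by rw [← hd, map_zero]; exact ha
    rw [hinj t h1]
    exact map_zero _
  · intro m
    obtain ⟨t, e, h⟩ := hsurj m
    exact ⟨colimit.ι (lcD J n Y) (op (op t)) e, (hd t e).trans h⟩

end GFaux

open CategoryTheory IsLocalRing
namespace GFaux
open Paper Limits
open scoped Pointwise
variable {R : Type u} [CommRing R]

lemma ext_smul_eq_zero {A : Type u} [AddCommGroup A] [Module R A] {Y : ModuleCat.{u} R} {n : ℕ}
    (r : R) (hr : ∀ a : A, r • a = 0) (e : Abelian.Ext (ModuleCat.of R A) Y n) : r • e = 0 := by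
  have h0 : r • 𝟙 (ModuleCat.of R A) = 0 := by
    refine ModuleCat.hom_ext (LinearMap.ext fun x => ?_)
    exact hr x
  have : r • e = (Abelian.Ext.mk₀ (r • 𝟙 (ModuleCat.of R A))).comp e (zero_add n) := by
    rw [Abelian.Ext.mk₀_smul, Abelian.Ext.smul_comp, Abelian.Ext.mk₀_id_comp]
  rw [this, h0, Abelian.Ext.mk₀_zero, Abelian.Ext.zero_comp]

lemma ext_comp_lsmul {A M : Type u} [AddCommGroup A] [Module R A] [AddCommGroup M] [Module R M]
    {n : ℕ} (r : R) (e : Abelian.Ext (ModuleCat.of R A) (ModuleCat.of R M) n) :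
    e.comp (Abelian.Ext.mk₀ (ModuleCat.ofHom (LinearMap.lsmul R M r))) (add_zero n) = r • e := by
  have h0 : ModuleCat.ofHom (LinearMap.lsmul R M r) = r • 𝟙 (ModuleCat.of R M) := by
    refine ModuleCat.hom_ext (LinearMap.ext fun x => ?_)
    rfl
  rw [h0, Abelian.Ext.smul_eq_comp_mk₀]

lemma extV {A : Type u} [AddCommGroup A] [Module R A] (rs : List R) :
    ∀ (M : Type u) [AddCommGroup M] [Module R M], RingTheory.Sequence.IsWeaklyRegular M rs →
      (∀ x ∈ rs, ∀ a : A, x • a = 0) → ∀ i, i < rs.length →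
      ∀ e : Abelian.Ext (ModuleCat.of R A) (ModuleCat.of R M) i, e = 0 := by
  induction rs with
  | nil => intro M _ _ _ _ i hi; simp at hi
  | cons x rs ih =>
    intro M _ _ hreg hA i hi e
    rw [RingTheory.Sequence.isWeaklyRegular_cons_iff] at hreg
    have hx := SES.smul hreg.1
    have h0 : e.comp (Abelian.Ext.mk₀ hx.sc.f) (add_zero i) = 0 := by
      rw [← ext_smul_eq_zero x (hA x (by simp)) e]
      exact ext_comp_lsmul x e
    cases i with
    | zero =>
      obtain ⟨y, rfl⟩ := (Abelian.Ext.mk₀_bijective _ _).2 e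
      rw [Abelian.Ext.mk₀_comp_mk₀] at h0
      have h1 : y ≫ hx.sc.f = 0 :=
        (Abelian.Ext.mk₀_bijective _ _).1 (h0.trans (Abelian.Ext.mk₀_zero _ _).symm)
      have := hx.shortExact.mono_f
      have h2 : y = 0 := zero_of_comp_mono hx.sc.f h1
      rw [h2, Abelian.Ext.mk₀_zero]
    | succ i =>
      obtain ⟨z, hz⟩ := Abelian.Ext.covariant_sequence_exact₁ _ hx.shortExact e h0 rfl
      obtain rfl : z = 0 := ih _ hreg.2 (fun x hx => hA x (by simp [hx])) i (by simpa using hi) z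
      exact hz.symm.trans (by simp)

lemma extI {A : Type u} [AddCommGroup A] [Module R A] (y : R) (rs : List R) :
    ∀ (M : Type u) [AddCommGroup M] [Module R M],
      RingTheory.Sequence.IsWeaklyRegular M (rs ++ [y]) →
      (∀ x ∈ rs, ∀ a : A, x • a = 0) →
      ∀ e : Abelian.Ext (ModuleCat.of R A) (ModuleCat.of R M) rs.length, y • e = 0 → e = 0 := by
  induction rs with
  | nil =>
    intro M _ _ hreg hA e he
    simp only [List.nil_append, RingTheory.Sequence.isWeaklyRegular_cons_iff] at hreg
    obtain ⟨f, rfl⟩ := (Abelian.Ext.mk₀_bijective _ _).2 e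
    rw [← Abelian.Ext.mk₀_smul] at he
    have h1 : y • f = 0 := (Abelian.Ext.mk₀_bijective _ _).1 (he.trans (Abelian.Ext.mk₀_zero _ _).symm)
    have : f = 0 := by
      refine ModuleCat.hom_ext (LinearMap.ext fun a => hreg.1 ?_)
      have := congrArg (fun g => g.hom a) h1
      exact this.trans (smul_zero y).symm
    rw [this, Abelian.Ext.mk₀_zero]
  | cons x rs ih =>
    intro M _ _ hreg hA e he
    rw [List.cons_append, RingTheory.Sequence.isWeaklyRegular_cons_iff] at hreg
    have hx := SES.smul hreg.1
    have hV : ∀ e' : Abelian.Ext (ModuleCat.of R A) (ModuleCat.of R M) rs.length, e' = 0 :=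
      extV (x :: rs) M (by
        rw [RingTheory.Sequence.isWeaklyRegular_cons_iff]
        exact ⟨hreg.1, ((RingTheory.Sequence.isWeaklyRegular_append_iff _ _ _).1 hreg.2).1⟩) hA
        _ (by simp)
    have h0 : e.comp (Abelian.Ext.mk₀ hx.sc.f) (add_zero _) = 0 := by
      rw [← ext_smul_eq_zero x (hA x (by simp)) e]
      exact ext_comp_lsmul x e
    obtain ⟨z, hz⟩ := Abelian.Ext.covariant_sequence_exact₁ _ hx.shortExact e h0 rfl
    have h2 : (y • z).comp hx.shortExact.extClass rfl = 0 := by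
      rw [Abelian.Ext.smul_comp, hz, he]
    obtain ⟨w, hw⟩ := Abelian.Ext.covariant_sequence_exact₃ _ hx.shortExact _ rfl h2
    obtain rfl : w = 0 := hV w
    have h3 : y • z = 0 := hw.symm.trans (by simp)
    obtain rfl : z = 0 := ih _ hreg.2 (fun x hx => hA x (by simp [hx])) z h3
    exact hz.symm.trans (by simp)

end GFaux

open CategoryTheory IsLocalRing
namespace GFaux
open Paper Limits
variable {R : Type u} [CommRing R]

lemma flat_localizedModule (y : R) (P : Type u) [AddCommGroup P] [Module R P]
    [Module.Flat R P] : Module.Flat R (LocalizedModule (Submonoid.powers y) P) := by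
  have : Module.Flat R (Localization (Submonoid.powers y)) := inferInstance
  exact Module.Flat.of_linearEquiv
    ((LocalizedModule.equivTensorProduct (Submonoid.powers y) P).restrictScalars R)

lemma SES.localized {A B C : Type u} [AddCommGroup A] [Module R A] [AddCommGroup B] [Module R B]
    [AddCommGroup C] [Module R C] {f : A →ₗ[R] B} {g : B →ₗ[R] C} (h : SES f g) (S : Submonoid R) :
    SES (IsLocalizedModule.map S (LocalizedModule.mkLinearMap S A)
        (LocalizedModule.mkLinearMap S B) f)
      (IsLocalizedModule.map S (LocalizedModule.mkLinearMap S B)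
        (LocalizedModule.mkLinearMap S C) g) :=
  ⟨IsLocalizedModule.map_injective S _ _ f h.inj, IsLocalizedModule.map_exact S _ _ _ f g h.exact,
    IsLocalizedModule.map_surjective S _ _ g h.surj⟩

lemma FD.localized (y : R) (n : ℕ) : ∀ (N : Type u) [AddCommGroup N] [Module R N],
    FD R n N → FD R n (LocalizedModule (Submonoid.powers y) N) := by
  induction n with
  | zero =>
    intro N _ _ hN
    have : Module.Flat R N := flat_iff_torZ.2 fun M _ _ => hN 1 (by lia) M
    have := flat_localizedModule y N
    exact FD.of_flat
  | succ n ih =>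
    intro N _ _ hN
    obtain ⟨P, K, _, _, _, _, f, g, hP, h⟩ := exists_ses R N
    exact FD.quot (h.localized (Submonoid.powers y)) (ih K (FD.syz h hN inferInstance))
      (flat_localizedModule y P)

lemma torZ_of_UDiv_XTor {x : R} {E : Type u} [AddCommGroup E] [Module R E] (hE : XTor x E)
    (i : ℕ) : ∀ {L : Type u} [AddCommGroup L] [Module R L], UDiv x L → TorZ R i L E := by
  induction i with
  | zero =>
    intro L _ _ hL
    refine subsingleton_of_forall_eq 0 fun e => ?_
    obtain ⟨y, rfl⟩ := (Abelian.Ext.mk₀_bijective _ _).2 e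
    have : y = 0 := by
      apply ModuleCat.hom_ext
      ext l m
      obtain ⟨k, hk⟩ := hE m
      obtain ⟨l, rfl⟩ := (hL.pow k).2 l
      have : y.hom (x ^ k • l) = x ^ k • y.hom l := map_smul _ _ _
      refine (DFunLike.congr_fun this m).trans ?_
      change (y.hom l) (x ^ k • m) = 0
      rw [hk]
      exact map_zero (y.hom l)
    rw [this, Abelian.Ext.mk₀_zero]
  | succ i ih =>
    intro L _ _ hL
    obtain ⟨P, K, f, g, h, hP, hK⟩ := hL.cover
    exact TorZ.right h (ih hK) (TorZ.of_flat _ _)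

lemma ext_eq_zero_of_UDiv {A L : Type u} [AddCommGroup A] [Module R A] [AddCommGroup L]
    [Module R L] {x : R} (hL : UDiv x L) (t : ℕ) (hA : ∀ a : A, x ^ t • a = 0) (i : ℕ)
    (e : Abelian.Ext (ModuleCat.of R A) (ModuleCat.of R L) i) : e = 0 := by
  let φ : L ≃ₗ[R] L := LinearEquiv.ofBijective (LinearMap.lsmul R L (x ^ t)) (hL.pow t)
  have h1 := ext_comp_lsmul (x ^ t) e
  rw [ext_smul_eq_zero _ hA] at h1
  have h2 : ModuleCat.ofHom (LinearMap.lsmul R L (x ^ t)) ≫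
      ModuleCat.ofHom φ.symm.toLinearMap = 𝟙 (ModuleCat.of R L) := by
    refine ModuleCat.hom_ext (LinearMap.ext fun l => ?_)
    exact φ.symm_apply_apply l
  rw [← Abelian.Ext.comp_mk₀_id e, ← h2, ← Abelian.Ext.mk₀_comp_mk₀,
    ← Abelian.Ext.comp_assoc (h₁₂ := add_zero i) (h₂₃ := add_zero 0) (h := by simp),
    h1, Abelian.Ext.zero_comp]

/-- killed by a power of each element of the list -/
def Kills (rs : List R) (A : Type u) [AddCommGroup A] [Module R A] : Prop :=
  ∀ x ∈ rs, ∃ t : ℕ, ∀ a : A, x ^ t • a = 0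

lemma exists_socle {N : Type u} [AddCommGroup N] [Module R N] (rs : List R)
    (hN : ∀ x ∈ rs, XTor x N) (n : N) (hn : n ≠ 0) :
    ∃ r : R, r • n ≠ 0 ∧ ∀ x ∈ rs, x • r • n = 0 := by
  classical
  induction rs with
  | nil => exact ⟨1, by simpa using hn, by simp⟩
  | cons x rs ih =>
    obtain ⟨r, hr, hr'⟩ := ih (fun x hx => hN x (by simp [hx]))
    have hex := hN x (by simp) (r • n)
    obtain ⟨k, hk, hmin⟩ : ∃ k, x ^ k • r • n = 0 ∧ ∀ m, m < k → x ^ m • r • n ≠ 0 :=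
      ⟨Nat.find hex, Nat.find_spec hex, fun m => Nat.find_min hex⟩
    cases k with
    | zero => rw [pow_zero, one_smul] at hk; exact absurd hk hr
    | succ k =>
      refine ⟨x ^ k * r, by rw [mul_smul]; exact hmin k (Nat.lt_succ_self k), ?_⟩
      intro z hz
      rw [mul_smul]
      rcases List.mem_cons.1 hz with rfl | hz
      · rw [smul_smul, ← pow_succ']; exact hk
      · rw [smul_comm, hr' z hz, smul_zero]

lemma regular_on {N : Type u} [AddCommGroup N] [Module R N] (rs : List R) (y : R)
    (hreg : RingTheory.Sequence.IsWeaklyRegular R (rs ++ [y]))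
    (hN : ∀ x ∈ rs, XTor x N)
    (ω : Abelian.Ext (ModuleCat.of R N) (ModuleCat.of R R) rs.length)
    (hω : ∀ (A : Type u) [AddCommGroup A] [Module R A], Kills rs A →
      ∀ i j (h : i + rs.length = j), Function.Bijective
        (fun e : Abelian.Ext (ModuleCat.of R A) (ModuleCat.of R N) i => e.comp ω h)) :
    ∀ n : N, y • n = 0 → n = 0 := by
  intro n hyn
  by_contra hn
  obtain ⟨r, hr, hr'⟩ := exists_socle rs hN n hn
  let J : Ideal R := Ideal.ofList rs
  have hJ : J ≤ LinearMap.ker (LinearMap.toSpanSingleton R N (r • n)) := by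
    refine Ideal.span_le.2 ?_
    intro x hx
    simpa using hr' x hx
  let f : (R ⧸ J) →ₗ[R] N := Submodule.liftQ J (LinearMap.toSpanSingleton R N (r • n)) hJ
  have hf : f (Submodule.Quotient.mk 1) = r • n :=
    (Submodule.liftQ_apply J _ _).trans (by simp)
  have hA : ∀ x ∈ rs, ∀ a : R ⧸ J, x • a = 0 := by
    intro x hx a
    obtain ⟨a, rfl⟩ := Submodule.Quotient.mk_surjective _ a
    rw [← Submodule.Quotient.mk_smul, Submodule.Quotient.mk_eq_zero]
    exact Ideal.mul_mem_right _ _ (Ideal.subset_span hx)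
  have hyf : y • ModuleCat.ofHom f = 0 := by
    refine ModuleCat.hom_ext (LinearMap.ext fun a => ?_)
    obtain ⟨a, rfl⟩ := Submodule.Quotient.mk_surjective _ a
    change y • f (Submodule.Quotient.mk a) = 0
    have : f (Submodule.Quotient.mk a) = a • r • n :=
      (Submodule.liftQ_apply J _ _).trans (by simp)
    rw [this, smul_comm y a, smul_comm y r, hyn, smul_zero, smul_zero]
  have h1 : y • (Abelian.Ext.mk₀ (ModuleCat.ofHom f)).comp ω (zero_add _) = 0 := by
    rw [← Abelian.Ext.smul_comp, ← Abelian.Ext.mk₀_smul, hyf, Abelian.Ext.mk₀_zero,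
      Abelian.Ext.zero_comp]
  have h2 := extI y rs R hreg hA _ h1
  have h3 : Abelian.Ext.mk₀ (ModuleCat.ofHom f) = 0 := by
    apply (hω (R ⧸ J) (fun x hx => ⟨1, by simpa using hA x hx⟩) 0 _ (zero_add _)).1
    exact h2.trans (by simp)
  have h4 : ModuleCat.ofHom f = 0 :=
    (Abelian.Ext.mk₀_bijective _ _).1 (h3.trans (Abelian.Ext.mk₀_zero _ _).symm)
  apply hr
  rw [← hf]
  exact congrArg (fun g => g.hom (Submodule.Quotient.mk 1)) h4

end GFaux

open CategoryTheory IsLocalRing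
namespace GFaux
open Paper Limits
variable {R : Type u} [CommRing R]

/-- The package of properties of the iterated Čech-type module. -/
structure Good (rs : List R) (n : ℕ) (N : Type u) [AddCommGroup N] [Module R N]
    (ω : Abelian.Ext (ModuleCat.of R N) (ModuleCat.of R R) n) : Prop where
  fd : FD R n N
  tor : ∀ x ∈ rs, XTor x N
  bij : ∀ (A : Type u) [AddCommGroup A] [Module R A], Kills rs A →
      ∀ i j (h : i + n = j), Function.Bijective
        (fun e : Abelian.Ext (ModuleCat.of R A) (ModuleCat.of R N) i => e.comp ω h)
  nz : ∀ (E : Type u) [AddCommGroup E] [Module R E], (∀ x ∈ rs, XTor x E) →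
      TorZ R n N E → TorZ R 0 R E

lemma Good.step {rs : List R} {y : R} {n : ℕ} {N L N' : Type u} [AddCommGroup N] [Module R N]
    [AddCommGroup L] [Module R L] [AddCommGroup N'] [Module R N']
    {ω : Abelian.Ext (ModuleCat.of R N) (ModuleCat.of R R) n} (hN : Good rs n N ω)
    (f : N →ₗ[R] L) (g : L →ₗ[R] N') (h : SES f g) (hL : UDiv y L) (hLfd : FD R n L)
    (hk : ∀ l, ∃ (k : ℕ) (m : N), y ^ k • l = f m) :
    Good (rs ++ [y]) (n + 1) N' (h.shortExact.extClass.comp ω (add_comm 1 n)) := by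
  refine ⟨?_, ?_, ?_, ?_⟩
  · intro i hi M _ _
    obtain ⟨i, rfl⟩ : ∃ j, i = j + 1 := ⟨i - 1, by lia⟩
    exact TorZ.right h (hN.fd i (by lia) M) (hLfd _ (by lia) M)
  · intro x hx c
    obtain ⟨l, rfl⟩ := h.surj c
    obtain ⟨k, m, hm⟩ := hk l
    rcases List.mem_append.1 hx with hx | hx
    · obtain ⟨j, hj⟩ := hN.tor x hx m
      refine ⟨j, ?_⟩
      have : x ^ j • l = 0 := by
        apply (hL.pow k).1
        simp only [smul_zero]
        rw [smul_comm, hm, ← map_smul, hj, map_zero]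
      rw [← map_smul, this, map_zero]
    · obtain rfl : x = y := by simpa using hx
      refine ⟨k, ?_⟩
      rw [← map_smul, hm]
      exact h.exact.apply_apply_eq_zero m
  · intro A _ _ hA i j hij
    obtain ⟨t, ht⟩ := hA y (by simp)
    have hz : ∀ i (e : Abelian.Ext (ModuleCat.of R A) (ModuleCat.of R L) i), e = 0 :=
      ext_eq_zero_of_UDiv hL t ht
    have hb := hN.bij A (fun x hx => hA x (by simp [hx])) (i + 1) j (by lia)
    have hassoc : ∀ e : Abelian.Ext (ModuleCat.of R A) (ModuleCat.of R N') i,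
        e.comp (h.shortExact.extClass.comp ω (add_comm 1 n)) hij =
          (e.comp h.shortExact.extClass rfl).comp ω (by lia) := by
      intro e
      exact (Abelian.Ext.comp_assoc e h.shortExact.extClass ω rfl (add_comm 1 n) (by lia)).symm
    constructor
    · intro e e' hee
      rw [← sub_eq_zero]
      simp only [hassoc] at hee
      have h1 := hb.1 hee
      have h2 : (e - e').comp h.shortExact.extClass rfl = 0 := by
        rw [sub_eq_add_neg, Abelian.Ext.add_comp, Abelian.Ext.neg_comp, h1, add_neg_cancel]
      obtain ⟨w, hw⟩ := Abelian.Ext.covariant_sequence_exact₃ _ h.shortExact _ rfl h2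
      obtain rfl : w = 0 := hz _ w
      exact hw.symm.trans (by simp)
    · intro e
      obtain ⟨e', rfl⟩ := hb.2 e
      obtain ⟨e'', rfl⟩ := Abelian.Ext.covariant_sequence_exact₁ _ h.shortExact e' (hz _ _) rfl
      exact ⟨e'', hassoc e''⟩
  · intro E _ _ hE hT
    exact hN.nz E (fun x hx => hE x (by simp [hx]))
      (TorZ.left h hT (torZ_of_UDiv_XTor (hE y (by simp)) n hL))

lemma Good.nil : Good (R := R) [] 0 R (Abelian.Ext.mk₀ (𝟙 (ModuleCat.of R R))) := by
  refine ⟨FD.of_flat, by simp, ?_, fun E _ _ _ h => h⟩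
  intro A _ _ _ i j hij
  obtain rfl : i = j := by simpa using hij
  have : (fun e : Abelian.Ext (ModuleCat.of R A) (ModuleCat.of R R) i =>
      e.comp (Abelian.Ext.mk₀ (𝟙 (ModuleCat.of R R))) hij) = id := by
    funext e
    exact Abelian.Ext.comp_mk₀_id e
  rw [this]
  exact Function.bijective_id

lemma exists_good (rs : List R) : RingTheory.Sequence.IsWeaklyRegular R rs →
    ∃ (N : ModuleCat.{u} R) (ω : Abelian.Ext (ModuleCat.of R N) (ModuleCat.of R R) rs.length),
      Good rs rs.length N ω := by
  induction rs using List.reverseRecOn with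
  | nil => exact fun _ => ⟨ModuleCat.of R R, _, Good.nil⟩
  | append_singleton rs y ih =>
    intro hreg
    obtain ⟨N, ω, hN⟩ := ih ((RingTheory.Sequence.isWeaklyRegular_append_iff _ _ _).1 hreg).1
    have hy := regular_on rs y hreg hN.tor ω hN.bij
    let S := Submonoid.powers y
    let ℓ : N →ₗ[R] LocalizedModule S N := LocalizedModule.mkLinearMap S N
    have hpow : ∀ (k : ℕ) (n : N), y ^ k • n = 0 → n = 0 := by
      intro k
      induction k with
      | zero => intro n hn; simpa using hn
      | succ k ihk =>
        intro n hn
        rw [pow_succ, mul_smul] at hn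
        exact hy n (ihk _ hn)
    have hℓ : Function.Injective ℓ := by
      rw [injective_iff_map_eq_zero]
      intro n hn
      obtain ⟨⟨_, k, rfl⟩, hs⟩ := (IsLocalizedModule.eq_zero_iff S ℓ).1 hn
      exact hpow k n hs
    have hk : ∀ l, ∃ (k : ℕ) (m : N), y ^ k • l = ℓ m := by
      intro l
      obtain ⟨⟨m, ⟨_, k, rfl⟩⟩, hm⟩ := IsLocalizedModule.surj S ℓ l
      exact ⟨k, m, hm⟩
    have hU : UDiv y (LocalizedModule S N) := UDiv.of_isLocalizedModule ℓ
    have hG := hN.step ℓ _ (SES.of_injective ℓ hℓ) hU (FD.localized y _ N hN.fd) hk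
    have hlen : (rs ++ [y]).length = rs.length + 1 := by simp
    rw [hlen]
    exact ⟨ModuleCat.of R _, _, hG⟩

end GFaux

open CategoryTheory IsLocalRing
namespace GFaux
open Paper Limits
variable {R : Type u} [CommRing R]

/-- the `J`-torsion submodule -/
def gam (J : Ideal R) (I : Type u) [AddCommGroup I] [Module R I] : Submodule R I where
  carrier := {e | ∃ t : ℕ, ∀ r ∈ J ^ t, r • e = 0}
  zero_mem' := ⟨0, by simp⟩
  add_mem' := by
    rintro a b ⟨s, hs⟩ ⟨t, ht⟩
    refine ⟨s + t, fun r hr => ?_⟩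
    rw [smul_add, hs r (Ideal.pow_le_pow_right (by lia) hr),
      ht r (Ideal.pow_le_pow_right (by lia) hr), add_zero]
  smul_mem' := by
    rintro c a ⟨s, hs⟩
    exact ⟨s, fun r hr => by rw [smul_comm, hs r hr, smul_zero]⟩

lemma exists_uniform (J : Ideal R) (I : Type u) [AddCommGroup I] [Module R I]
    (F : Type u) [AddCommGroup F] [Module R F] [Module.Finite R F]
    (f : F →ₗ[R] gam J I) : ∃ t : ℕ, ∀ r ∈ J ^ t, ∀ a, r • f a = 0 := by
  classical
  obtain ⟨s, hs⟩ := Module.Finite.fg_top (R := R) (M := F)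
  choose t ht using fun a => (f a).2
  refine ⟨s.sup t, fun r hr a => ?_⟩
  have ha : a ∈ Submodule.span R (s : Set F) := hs ▸ Submodule.mem_top
  induction ha using Submodule.span_induction with
  | mem a ha =>
    apply Subtype.ext
    exact ht a r (Ideal.pow_le_pow_right (Finset.le_sup ha) hr)
  | zero => simp
  | add a b _ _ h1 h2 => rw [map_add, smul_add, h1, h2, add_zero]
  | smul c a _ h => rw [map_smul, smul_comm, h, smul_zero]

lemma gam_injective [IsNoetherianRing R] (J : Ideal R) (I : Type u) [AddCommGroup I] [Module R I]
    (hI : Module.Injective R I) : Module.Injective R (gam J I) := by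
  apply Module.Baer.injective
  intro K f
  obtain ⟨t, ht⟩ := exists_uniform J I K f
  obtain ⟨k, hk⟩ := Ideal.exists_pow_inf_eq_pow_smul J (N := (K : Submodule R R))
  have hAR : ∀ a (ha : a ∈ K), a ∈ J ^ (t + k) → f ⟨a, ha⟩ = 0 := by
    intro a ha haJ
    have h1 : a ∈ J ^ (t + k) • (⊤ : Submodule R R) ⊓ K := ⟨by simpa using haJ, ha⟩
    rw [hk (t + k) (by lia)] at h1
    have h2 : a ∈ J ^ t • K := by
      have : t + k - k = t := by lia
      rw [this] at h1
      exact Submodule.smul_mono le_rfl inf_le_right h1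
    clear haJ h1
    have h3 : ∀ b ∈ J ^ t • K, ∃ hb : b ∈ K, f ⟨b, hb⟩ = 0 := by
      intro b hb
      induction hb using Submodule.smul_induction_on' with
      | smul r hr b hb =>
        refine ⟨K.mul_mem_left r hb, ?_⟩
        exact (map_smul f r ⟨b, hb⟩).trans (ht r hr _)
      | add b hb c hc h1 h2 =>
        obtain ⟨h1, h1'⟩ := h1
        obtain ⟨h2, h2'⟩ := h2
        refine ⟨K.add_mem h1 h2, ?_⟩
        refine (map_add f ⟨b, h1⟩ ⟨c, h2⟩).trans ?_
        rw [h1', h2', add_zero]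
    exact (h3 a h2).2
  let q : K →ₗ[R] R ⧸ J ^ (t + k) := (J ^ (t + k)).mkQ ∘ₗ K.subtype
  have hq : LinearMap.ker q ≤ LinearMap.ker ((gam J I).subtype ∘ₗ f) := by
    rintro ⟨a, ha⟩ h
    have h1 : a ∈ J ^ (t + k) := by
      have h2 : (J ^ (t + k)).mkQ a = 0 := h
      rwa [Submodule.mkQ_apply, Submodule.Quotient.mk_eq_zero] at h2
    have := hAR a ha h1
    rw [LinearMap.mem_ker, LinearMap.comp_apply, this, map_zero]
  let j : (K ⧸ LinearMap.ker q) →ₗ[R] R ⧸ J ^ (t + k) := (LinearMap.ker q).liftQ q le_rfl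
  have hj : Function.Injective j := by
    rw [← LinearMap.ker_eq_bot]
    exact Submodule.ker_liftQ_eq_bot _ _ _ le_rfl
  obtain ⟨σ, hσ⟩ := hI.out j hj ((LinearMap.ker q).liftQ _ hq)
  have hv : σ (Submodule.Quotient.mk 1) ∈ gam J I := by
    refine ⟨t + k, fun r hr => ?_⟩
    rw [← map_smul, ← Submodule.Quotient.mk_smul]
    have : (Submodule.Quotient.mk (r • 1) : R ⧸ J ^ (t + k)) = 0 := by
      rw [Submodule.Quotient.mk_eq_zero]; simpa using hr
    rw [this, map_zero]
  refine ⟨LinearMap.toSpanSingleton R _ ⟨_, hv⟩, fun y hy => ?_⟩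
  apply Subtype.ext
  have h1 := hσ (Submodule.Quotient.mk ⟨y, hy⟩)
  have h2 : σ (Submodule.Quotient.mk y) = f ⟨y, hy⟩ := h1
  rw [← h2]
  change y • σ (Submodule.Quotient.mk 1) = _
  rw [← map_smul, ← Submodule.Quotient.mk_smul]
  simp

lemma exists_E [IsNoetherianRing R] [IsLocalRing R] :
    ∃ E : ModuleCat.{u} R, Module.Injective R E ∧ (∀ x ∈ maximalIdeal R, XTor x E) ∧
      ¬ TorZ R 0 R E := by
  obtain ⟨I, f, hI, hf⟩ := exists_injective (R := R) (R ⧸ maximalIdeal R)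
  refine ⟨ModuleCat.of R (gam (maximalIdeal R) I), gam_injective _ I hI, ?_, ?_⟩
  · rintro x hx ⟨e, t, ht⟩
    exact ⟨t, Subtype.ext (ht _ (Ideal.pow_mem_pow hx t))⟩
  · intro h
    have hne : f (Submodule.Quotient.mk 1) ≠ 0 := by
      intro h0
      have h1 := hf (h0.trans (map_zero f).symm)
      rw [Submodule.Quotient.mk_eq_zero] at h1
      exact (Ideal.ne_top_iff_one _).1 (IsLocalRing.maximalIdeal.isMaximal R).ne_top h1
    have hmem : f (Submodule.Quotient.mk 1) ∈ gam (maximalIdeal R) I := by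
      refine ⟨1, fun r hr => ?_⟩
      rw [← map_smul, ← Submodule.Quotient.mk_smul]
      have : (Submodule.Quotient.mk (r • 1) : R ⧸ maximalIdeal R) = 0 := by
        rw [Submodule.Quotient.mk_eq_zero]; simpa using hr
      rw [this, map_zero]
    apply hne
    suffices hs : (⟨_, hmem⟩ : gam (maximalIdeal R) I) = 0 from congrArg Subtype.val hs
    refine CharacterModule.eq_zero_of_character_apply fun c => ?_
    let φ : ModuleCat.of R R ⟶ ModuleCat.of R (CharacterModule (gam (maximalIdeal R) I)) :=
      ModuleCat.ofHom (LinearMap.toSpanSingleton R _ c)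
    have h1 : Abelian.Ext.mk₀ φ = 0 := h.eq_zero _
    have h2 : φ = 0 :=
      (Abelian.Ext.mk₀_bijective _ _).1 (h1.trans (Abelian.Ext.mk₀_zero _ _).symm)
    have h3 : (1 : R) • c = 0 := congrArg (fun g => g.hom (1 : R)) h2
    rw [one_smul] at h3
    rw [h3]; rfl

end GFaux

open CategoryTheory IsLocalRing
namespace GFaux
open Paper Limits
variable {R : Type u} [CommRing R]

section
variable {n : ℕ} {N : Type u} [AddCommGroup N] [Module R N]
    (ω : Abelian.Ext (ModuleCat.of R N) (ModuleCat.of R R) n)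

/-- composition with the class `ω` -/
noncomputable def compω (X : ModuleCat.{u} R) :
    (X ⟶ ModuleCat.of R N) →ₗ[R] Abelian.Ext X (ModuleCat.of R R) n where
  toFun f := (Abelian.Ext.mk₀ f).comp ω (zero_add n)
  map_add' f g := by rw [Abelian.Ext.mk₀_add, Abelian.Ext.add_comp]
  map_smul' r f := by rw [Abelian.Ext.mk₀_smul, Abelian.Ext.smul_comp]; rfl

/-- evaluation at one -/
noncomputable def evOne (J : Ideal R) (t : ℕ) : (qp J t ⟶ ModuleCat.of R N) →ₗ[R] N where
  toFun f := f.hom (Submodule.Quotient.mk 1)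
  map_add' f g := rfl
  map_smul' r f := rfl

lemma evOne_inj (J : Ideal R) (t : ℕ) : Function.Injective (evOne (N := N) J t) := by
  rw [injective_iff_map_eq_zero]
  intro f hf
  refine ModuleCat.hom_ext (LinearMap.ext fun x => ?_)
  obtain ⟨x, rfl⟩ := Submodule.Quotient.mk_surjective _ x
  have h1 : (Submodule.Quotient.mk x : R ⧸ J ^ t) = x • Submodule.Quotient.mk 1 := by
    rw [← Submodule.Quotient.mk_smul]; simp
  rw [h1]
  refine (map_smul f.hom x _).trans ?_
  have h2 : f.hom (Submodule.Quotient.mk 1) = 0 := hf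
  rw [h2, smul_zero]; rfl

lemma lcoh_good {rs : List R} (J : Ideal R) (hrs : ∀ x ∈ rs, x ∈ J) (hN : Good rs n N ω)
    (hT : ∀ m : N, ∃ t : ℕ, ∀ r ∈ J ^ t, r • m = 0) :
    Nonempty ((localCohomology J n).obj (ModuleCat.of R R) ≃ₗ[R] N) := by
  have hbij : ∀ t, Function.Bijective (compω ω (qp J t)) := by
    intro t
    refine (hN.bij (R ⧸ J ^ t) ?_ 0 n (zero_add n)).comp (Abelian.Ext.mk₀_bijective _ _)
    intro x hx
    refine ⟨t, fun a => ?_⟩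
    obtain ⟨a, rfl⟩ := Submodule.Quotient.mk_surjective _ a
    rw [← Submodule.Quotient.mk_smul, Submodule.Quotient.mk_eq_zero]
    exact Ideal.mul_mem_right _ _ (Ideal.pow_mem_pow (hrs x hx) t)
  let Φ : ∀ t, (qp J t ⟶ ModuleCat.of R N) ≃ₗ[R]
      Abelian.Ext (qp J t) (ModuleCat.of R R) n := fun t => LinearEquiv.ofBijective _ (hbij t)
  let Ψ : ∀ t, OExt n (qp J t) (ModuleCat.of R R) ≃ₗ[R] (qp J t ⟶ ModuleCat.of R N) :=
    fun t => (theta n _ _).trans (Φ t).symm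
  have hΨ : ∀ t e, (Abelian.Ext.mk₀ (Ψ t e)).comp ω (zero_add n) = theta n _ _ e :=
    fun t e => (Φ t).apply_symm_apply (theta n _ _ e)
  refine lcoh_equiv J n _ N (fun t => evOne J t ∘ₗ (Ψ t).toLinearMap) ?_ ?_ ?_
  · intro t
    exact (evOne_inj J t).comp (Ψ t).injective
  · intro m
    obtain ⟨t, ht⟩ := hT m
    let f : (R ⧸ J ^ t) →ₗ[R] N := Submodule.liftQ (J ^ t) (LinearMap.toSpanSingleton R N m)
      (fun r hr => ht r hr)
    refine ⟨t, (Ψ t).symm (ModuleCat.ofHom f), ?_⟩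
    rw [LinearMap.comp_apply]
    have h1 : (Ψ t).toLinearMap ((Ψ t).symm (ModuleCat.ofHom f)) = ModuleCat.ofHom f :=
      (Ψ t).apply_symm_apply _
    rw [h1]
    change (1 : R) • m = m
    rw [one_smul]
  · intro s t h e
    have h1 : Ψ t (OExt.res n (qpm J h) _ e) = qpm J h ≫ Ψ s e := by
      apply (hbij t).1
      refine (hΨ t _).trans ?_
      rw [theta_nat, ← hΨ s e]
      change _ = (Abelian.Ext.mk₀ (qpm J h ≫ Ψ s e)).comp ω (zero_add n)
      rw [← Abelian.Ext.mk₀_comp_mk₀]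
      exact (Abelian.Ext.comp_assoc _ _ _ (zero_add 0) (zero_add n) (by simp)).symm
    refine (congrArg (evOne J t) h1).trans ?_
    rfl

end

lemma resDimLE_mono (P : ModuleCat.{u} R → Prop) {m n : ℕ} (h : m ≤ n) (M : ModuleCat.{u} R)
    (hm : ResDimLE R P m M) : ResDimLE R P n M := by
  induction h with
  | refl => exact hm
  | step _ ih => exact Or.inl ih

lemma resDim_eq_iff (P : ModuleCat.{u} R → Prop) (M : ModuleCat.{u} R) (d : ℕ) :
    ResDim R P M = d ↔ ResDimLE R P d M ∧ ∀ k, k < d → ¬ ResDimLE R P k M := by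
  unfold ResDim
  set S := {n : ℕ∞ | ∃ k : ℕ, (k : ℕ∞) = n ∧ ResDimLE R P k M} with hS
  constructor
  · intro h
    have hne : S.Nonempty := by
      by_contra hne
      rw [Set.not_nonempty_iff_eq_empty] at hne
      rw [hne, sInf_empty] at h
      exact absurd h (by simp)
    obtain ⟨k, hk, hk'⟩ := csInf_mem hne
    rw [h] at hk
    obtain rfl : k = d := by exact_mod_cast hk
    refine ⟨hk', fun j hj hj' => ?_⟩
    have : sInf S ≤ j := sInf_le ⟨j, rfl, hj'⟩
    rw [h] at this
    have : k ≤ j := by exact_mod_cast this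
    lia
  · rintro ⟨h1, h2⟩
    apply le_antisymm
    · exact sInf_le ⟨d, rfl, h1⟩
    · refine le_sInf ?_
      rintro _ ⟨k, rfl, hk⟩
      by_contra hlt
      exact h2 k (by simpa using hlt) hk

end GFaux

open CategoryTheory IsLocalRing
namespace GFaux
open Paper Limits
variable {R : Type u} [CommRing R]

lemma withBot_aux (x : WithBot ℕ∞) (n d : ℕ) (h : x + n = d) : n ≤ d ∧ (n = d → x ≤ 0) := by
  induction x with
  | bot => exact absurd h (by rw [WithBot.bot_add]; exact WithBot.bot_ne_coe)
  | coe x =>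
    induction x with
    | top =>
      have h' : (⊤ : ℕ∞) + n = d := by exact_mod_cast h
      simp at h'
    | coe x =>
      have h' : x + n = d := by exact_mod_cast h
      refine ⟨by lia, fun hn => ?_⟩
      obtain rfl : x = 0 := by lia
      exact le_of_eq rfl

lemma moduleDim_self : moduleDim R R = ringKrullDim R := by
  have h : Module.annihilator R R = ⊥ := Module.annihilator_eq_bot.2 inferInstance
  unfold moduleDim
  rw [h]
  exact ringKrullDim_eq_of_ringEquiv (RingEquiv.quotientBot R)

lemma isCM_iff [IsLocalRing R] (d : ℕ) (hdim : ringKrullDim R = (d : WithBot ℕ∞)) :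
    IsCohenMacaulayRing R ↔ depth R R = d := by
  unfold IsCohenMacaulayRing IsCohenMacaulayModule
  rw [moduleDim_self, hdim]
  exact WithBot.coe_inj

section
variable [IsNoetherianRing R] [IsLocalRing R]

lemma length_le (d : ℕ) (hdim : ringKrullDim R = (d : WithBot ℕ∞)) (rs : List R)
    (h : RingTheory.Sequence.IsRegular R rs) : rs.length ≤ d :=
  (withBot_aux _ _ d ((ringKrullDim_add_length_eq_ringKrullDim_of_isRegular rs h).trans hdim)).1

lemma depth_eq_iff (d : ℕ) (hdim : ringKrullDim R = (d : WithBot ℕ∞)) :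
    depth R R = d ↔ ∃ rs : List R, rs.length = d ∧ (∀ x ∈ rs, x ∈ maximalIdeal R) ∧
      RingTheory.Sequence.IsRegular R rs := by
  unfold depth
  set S := {n : ℕ∞ | ∃ rs : List R, (rs.length : ℕ∞) = n ∧ (∀ x ∈ rs, x ∈ maximalIdeal R) ∧
    RingTheory.Sequence.IsRegular R rs} with hS
  constructor
  · intro h
    have : Nonempty S := ⟨⟨0, [], rfl, by simp,
      (isRegular_iff_isWeaklyRegular_of_subset_maximalIdeal (by simp)).2 (by simp)⟩⟩
    have hm := ENat.sSup_mem_of_nonempty_of_lt_top (s := S) (by rw [h]; exact ENat.natCast_lt_top d)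
    rw [h] at hm
    obtain ⟨rs, h1, h2⟩ := hm
    exact ⟨rs, by exact_mod_cast h1, h2⟩
  · rintro ⟨rs, h1, h2⟩
    apply le_antisymm
    · refine sSup_le ?_
      rintro _ ⟨xs, rfl, h3, h4⟩
      exact_mod_cast length_le d hdim xs h4
    · exact le_sSup ⟨rs, by rw [h1], h2⟩

lemma le_radical (d : ℕ) (hdim : ringKrullDim R = (d : WithBot ℕ∞)) (rs : List R)
    (h : RingTheory.Sequence.IsRegular R rs) (hl : rs.length = d) :
    maximalIdeal R ≤ (Ideal.ofList rs).radical := by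
  have h0 := (withBot_aux _ _ d
    ((ringKrullDim_add_length_eq_ringKrullDim_of_isRegular rs h).trans hdim)).2 hl
  have h1 : Ring.KrullDimLE 0 (R ⧸ Ideal.ofList rs) := Ring.krullDimLE_iff.2 h0
  rw [Ring.krullDimLE_zero_iff] at h1
  rw [Ideal.radical_eq_sInf]
  refine le_sInf ?_
  rintro p ⟨hp, hp'⟩
  have h2 := h1 _ (Ideal.isPrime_map_quotientMk_of_isPrime hp)
  have h3 := Ideal.comap_isMaximal_of_surjective (Ideal.Quotient.mk (Ideal.ofList rs))
    Ideal.Quotient.mk_surjective (H := h2)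
  rw [Ideal.comap_map_quotientMk, sup_eq_right.2 hp] at h3
  exact (IsLocalRing.eq_maximalIdeal h3).ge

lemma forward (d : ℕ) (hdim : ringKrullDim R = (d : WithBot ℕ∞)) (h : IsCohenMacaulayRing R) :
    GflatDim R (lcoh R (maximalIdeal R) d R) = d := by
  rw [isCM_iff d hdim, depth_eq_iff d hdim] at h
  obtain ⟨rs, hl, hm, hreg⟩ := h
  have hrad := le_radical d hdim rs hreg hl
  subst hl
  obtain ⟨N, ω, hN⟩ := exists_good rs hreg.toIsWeaklyRegular
  have hT : ∀ m : N, ∃ t : ℕ, ∀ r ∈ maximalIdeal R ^ t, r • m = 0 := by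
    intro m
    let K : Ideal R := LinearMap.ker (LinearMap.toSpanSingleton R N m)
    have hK : Ideal.ofList rs ≤ K.radical := by
      refine Ideal.span_le.2 fun x hx => ?_
      obtain ⟨k, hk⟩ := hN.tor x hx m
      exact ⟨k, hk⟩
    have hK' : maximalIdeal R ≤ K.radical := hrad.trans (Ideal.radical_le_radical_iff.2 hK)
    obtain ⟨t, ht⟩ := Ideal.exists_pow_le_of_le_radical_of_fg hK'
      (IsNoetherian.noetherian (maximalIdeal R))
    exact ⟨t, fun r hr => ht hr⟩
  obtain ⟨e⟩ := lcoh_good ω (maximalIdeal R) hm hN hT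
  unfold GflatDim
  rw [resDim_eq_iff]
  constructor
  · apply resDim_of_FD
    intro i hi M _ _
    exact (hN.fd i hi M).congr e.symm
  · intro k hk hres
    obtain ⟨E, hE, hE', hE''⟩ := exists_E (R := R)
    apply hE''
    apply hN.nz E (fun x hx => hE' x (hm x hx))
    exact (torZ_of_resDim k _ hres _ hk E hE).congr e

lemma exists_max (n : ℕ) (h : ∀ rs : List R, (∀ x ∈ rs, x ∈ maximalIdeal R) →
    RingTheory.Sequence.IsRegular R rs → rs.length < n) :
    ∃ rs : List R, (∀ x ∈ rs, x ∈ maximalIdeal R) ∧ RingTheory.Sequence.IsWeaklyRegular R rs ∧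
      rs.length < n ∧ ∃ φ : (R ⧸ maximalIdeal R) →ₗ[R]
        R ⧸ (Ideal.ofList rs • ⊤ : Submodule R R), Function.Injective φ := by
  let Q : ℕ → Prop := fun t => ∃ rs : List R, rs.length = t ∧ (∀ x ∈ rs, x ∈ maximalIdeal R) ∧
    RingTheory.Sequence.IsRegular R rs
  have hQ0 : Q 0 := ⟨[], rfl, by simp,
      (isRegular_iff_isWeaklyRegular_of_subset_maximalIdeal (by simp)).2 (by simp)⟩
  have hQn : ¬ Q n := by
    rintro ⟨rs, h1, h2, h3⟩
    exact absurd (h rs h2 h3) (by lia)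
  obtain ⟨t, ht, ht'⟩ : ∃ t, Q t ∧ ¬ Q (t + 1) := by
    by_contra hcon
    push Not at hcon
    exact hQn (Nat.rec hQ0 (fun t ih => hcon t ih) n)
  obtain ⟨rs, hl, hm, hreg⟩ := ht
  refine ⟨rs, hm, hreg.toIsWeaklyRegular, h rs hm hreg, ?_⟩
  have hns : ¬ Subsingleton ((R ⧸ maximalIdeal R) →ₗ[R]
      R ⧸ (Ideal.ofList rs • ⊤ : Submodule R R)) := by
    rw [IsSMulRegular.subsingleton_linearMap_iff]
    rintro ⟨r, hr, hr'⟩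
    rw [Ideal.annihilator_quotient] at hr
    apply ht'
    have hm' : ∀ x ∈ rs ++ [r], x ∈ maximalIdeal R := by
      intro x hx
      rcases List.mem_append.1 hx with hx | hx
      · exact hm x hx
      · obtain rfl : x = r := by simpa using hx
        exact hr
    refine ⟨rs ++ [r], by simp [hl], hm', ?_⟩
    rw [isRegular_iff_isWeaklyRegular_of_subset_maximalIdeal hm',
      RingTheory.Sequence.isWeaklyRegular_append_iff]
    refine ⟨hreg.toIsWeaklyRegular, ?_⟩
    rw [RingTheory.Sequence.isWeaklyRegular_cons_iff]
    exact ⟨hr', by simp⟩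
  rw [not_subsingleton_iff_nontrivial] at hns
  obtain ⟨φ, hφ⟩ := exists_ne (0 : (R ⧸ maximalIdeal R) →ₗ[R]
      R ⧸ (Ideal.ofList rs • ⊤ : Submodule R R))
  have : IsSimpleModule R (R ⧸ maximalIdeal R) :=
    isSimpleModule_iff_isCoatom.2 (IsLocalRing.maximalIdeal.isMaximal R).out
  exact ⟨φ, (LinearMap.injective_or_eq_zero φ).resolve_right hφ⟩

lemma backward (d : ℕ) (hdim : ringKrullDim R = (d : WithBot ℕ∞))
    (h : GflatDim R (lcoh R (maximalIdeal R) d R) = d) : IsCohenMacaulayRing R := by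
  rw [isCM_iff d hdim, depth_eq_iff d hdim]
  by_contra hcon
  have hlt : ∀ rs : List R, (∀ x ∈ rs, x ∈ maximalIdeal R) →
      RingTheory.Sequence.IsRegular R rs → rs.length < d := by
    intro rs h1 h2
    refine lt_of_le_of_ne (length_le d hdim rs h2) fun h3 => hcon ⟨rs, h3, h1, h2⟩
  obtain ⟨rs, h1, h2, h3, h4⟩ := exists_max d hlt
  obtain ⟨n, rfl⟩ : ∃ n, d = n + 1 := ⟨d - 1, by lia⟩
  unfold GflatDim at h
  rw [resDim_eq_iff] at h
  exact h.2 n (Nat.lt_succ_self n) (backward_core n _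
    (fun x hx => lcoh_XTor (maximalIdeal R) (n + 1) (ModuleCat.of R R) x hx) h.1 rs h2 h3 h4)

end

end GFaux

open Paper IsLocalRing

/-- **Corollary 4.4.** Let `(R, 𝔪)` be a Noetherian local ring with `dim R = d`. Then
`R` is Cohen-Macaulay iff `Gfd_R H^d_𝔪(R) = d`. -/
theorem isCohenMacaulayRing_iff_GflatDim_localCohomology
    (R : Type u) [CommRing R] [IsNoetherianRing R] [IsLocalRing R]
    (d : ℕ) (hdim : ringKrullDim R = (d : WithBot ℕ∞)) :
    IsCohenMacaulayRing R ↔ GflatDim R (lcoh R (maximalIdeal R) d R) = d := by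
  exact ⟨GFaux.forward d hdim, GFaux.backward d hdim⟩
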